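/- arXiv:math/0506303 — 3 statements merged into one kernel-verified Lean document; each statement's English description precedes it below -/
import Mathlib

section
/- Let m ≥ 3, let γ be the growth function of the Mealy automaton B_m, and let γ^(i) denote its i-th finite difference. Then for every integer n ≥ m−1, γ^(m−2)(n) = ⌊(n−m+1)/2⌋ + 2. -/
/-- The sequence of states visited by a Mealy automaton with transition function `tr`,
started at state `q`, while reading the infinite word `u`. -/
def stateSeq {X Q : Type*} (tr : X → Q → Q) (q : Q) (u : ℕ → X) : ℕ → Q
  | 0 => q
  | k + 1 => tr (u k) (stateSeq tr q u k)

/-- The automatic transformation of infinite words defined by the Mealy automaton with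
transition function `tr` and output function `out` at the state `q`. -/
def autTrans {X Q : Type*} (tr : X → Q → Q) (out : X → Q → X) (q : Q) (u : ℕ → X) : ℕ → X :=
  fun n => out (u n) (stateSeq tr q u n)

/-- The transformation given by a word of states: the product (composition, applied from
right to left) of the corresponding automatic transformations. -/
def wordTrans {X Q : Type*} (tr : X → Q → Q) (out : X → Q → X) (w : List Q) :
    (ℕ → X) → (ℕ → X) :=
  (w.map (autTrans tr out)).foldr (· ∘ ·) id

/-- The growth function of a Mealy automaton: `growth tr out n` is the number of distinct
transformations of infinite words obtained as compositions of exactly `n` automatic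
transformations of the automaton. -/
noncomputable def growth {X Q : Type*} (tr : X → Q → Q) (out : X → Q → X) (n : ℕ) : ℕ :=
  Set.ncard { g : (ℕ → X) → (ℕ → X) | ∃ w : List Q, w.length = n ∧ wordTrans tr out w = g }

/-- The `i`-th finite difference of a function `γ`. -/
def fdiff (γ : ℕ → ℤ) : ℕ → ℕ → ℤ
  | 0, n => γ n
  | i + 1, n => fdiff γ i n - fdiff γ i (n - 1)

/-- Output function of the automaton `B_m`: at `q0` the output swaps `x0` and `x1` and fixes
every other letter; at `q1` the output sends `x_i` to `x_{i+1}` for `i ≤ m−2` and fixes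
`x_{m−1}`. -/
def bmOut (m : ℕ) : Fin m → Fin 2 → Fin m := fun x q =>
  if q = 0 then
    if (x : ℕ) = 0 then ⟨1 % m, Nat.mod_lt 1 x.pos⟩
    else if (x : ℕ) = 1 then ⟨0, x.pos⟩
    else x
  else ⟨min (x.val + 1) (m - 1), by have := x.pos; omega⟩

/-- Transition function of the automaton `B_m`: from `q0` the transition goes to `q1` on
reading `x2` and stays at `q0` otherwise; from `q1` it goes to `q0` on reading `x0` and
stays at `q1` otherwise. -/
def bmTr (m : ℕ) : Fin m → Fin 2 → Fin 2 := fun x q =>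
  if q = 0 then (if (x : ℕ) = 2 then 1 else 0)
  else (if (x : ℕ) = 0 then 0 else 1)

/-- The automatic transformations `f0, f1` of the automaton `B_m` at states `q0, q1`. -/
def bmF (m : ℕ) (q : Fin 2) : (ℕ → Fin m) → (ℕ → Fin m) := autTrans (bmTr m) (bmOut m) q

namespace BM

/-- Output on letters as natural numbers. -/
def nOut (m x : ℕ) (q : Fin 2) : ℕ :=
  if q = 0 then (if x = 0 then 1 else if x = 1 then 0 else x) else min (x + 1) (m - 1)

/-- Transition on letters as natural numbers. -/
def nTr (x : ℕ) (q : Fin 2) : Fin 2 :=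
  if q = 0 then (if x = 2 then 1 else 0) else (if x = 0 then 0 else 1)

/-- Output letter of the word `w` of states on the letter `x`. -/
def O (m x : ℕ) : List (Fin 2) → ℕ
  | [] => x
  | q :: w => nOut m (O m x w) q

/-- Section of the word `w` of states at the letter `x`. -/
def S (m x : ℕ) : List (Fin 2) → List (Fin 2)
  | [] => []
  | q :: w => nTr (O m x w) q :: S m x w

/-- Minimal position (counted from the right) of a state `1` with parity `r`. -/
def mp (r : ℕ) : List (Fin 2) → Option ℕ
  | [] => none
  | q :: w => match mp r w with
    | some p => some p
    | none => if q = 1 ∧ w.length % 2 = r then some w.length else none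

/-- The invariant classifying transformations. -/
def key : ℕ → List (Fin 2) → List (Option ℕ)
  | 0, w => [mp 0 w, mp 1 w]
  | _ + 1, [] => []
  | k + 1, q :: w => if q = 0 then some 0 :: key (k + 1) w else some 1 :: key k w

theorem fin2 (q : Fin 2) : q = 0 ∨ q = 1 := by omega

theorem S_len (m x : ℕ) (w : List (Fin 2)) : (S m x w).length = w.length := by
  induction w with
  | nil => rfl
  | cons q w ih => simp [S, ih]

theorem O_append (m x : ℕ) (A B : List (Fin 2)) : O m x (A ++ B) = O m (O m x B) A := by
  induction A with
  | nil => rfl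
  | cons q w ih => simp [O, ih]

theorem S_append (m x : ℕ) (A B : List (Fin 2)) :
    S m x (A ++ B) = S m (O m x B) A ++ S m x B := by
  induction A with
  | nil => rfl
  | cons q w ih => simp [S, ih, O_append]

theorem O_lt (m x : ℕ) (hm : 3 ≤ m) (hx : x < m) (w : List (Fin 2)) : O m x w < m := by
  induction w with
  | nil => exact hx
  | cons q w ih => simp only [O, nOut]; split_ifs <;> omega

theorem ge2 (m x : ℕ) (hm : 3 ≤ m) (hx : 2 ≤ x) (w : List (Fin 2)) : 2 ≤ O m x w := by
  induction w with
  | nil => exact hx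
  | cons q w ih => simp only [O, nOut]; split_ifs <;> omega

theorem mp_cons_none {r : ℕ} {q : Fin 2} {w : List (Fin 2)} (h : mp r (q :: w) = none) :
    mp r w = none ∧ ¬ (q = 1 ∧ w.length % 2 = r) := by
  rw [mp] at h
  split at h
  · simp at h
  · rename_i h1
    refine ⟨h1, ?_⟩
    intro h2
    simp [h2] at h

theorem mp_none (m x r : ℕ) (hm : 3 ≤ m) (hx : x + r = 1) (w : List (Fin 2))
    (h : mp r w = none) :
    O m x w = (x + w.length) % 2 ∧ S m x w = List.replicate w.length 0 := by
  induction w with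
  | nil => simp [O, S]; omega
  | cons q w ih =>
    obtain ⟨h1, h2⟩ := mp_cons_none h
    obtain ⟨i1, i2⟩ := ih h1
    rcases fin2 q with rfl | rfl
    · refine ⟨?_, ?_⟩
      · simp only [O, nOut, i1, List.length_cons]; simp; split_ifs <;> omega
      · simp only [S, nTr, i1, i2, List.length_cons, List.replicate_succ]
        simp; omega
    · have h3 : (x + w.length) % 2 = 0 := by
        have : ¬ (w.length % 2 = r) := fun h => h2 ⟨rfl, h⟩
        omega
      have h3' : (x + (w.length + 1)) % 2 = 1 := by omega
      refine ⟨?_, ?_⟩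
      · simp only [O, nOut, i1, List.length_cons, h3, h3']
        simp; omega
      · simp only [S, nTr, i1, i2, List.length_cons, List.replicate_succ, h3]
        simp

theorem mp_hit {r : ℕ} (A s : List (Fin 2)) (hs : mp r s = none) (hr : s.length % 2 = r) :
    mp r (A ++ 1 :: s) = some s.length := by
  induction A with
  | nil => simp [mp, hs, hr]
  | cons q A ih => simp [mp, ih]

theorem mp_zero (r n : ℕ) : mp r (List.replicate n 0) = none := by
  induction n with
  | zero => rfl
  | succ n ih => simp [List.replicate_succ, mp, ih]

theorem mp_dec {r p : ℕ} {w : List (Fin 2)} (h : mp r w = some p) :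
    ∃ A s, w = A ++ 1 :: s ∧ s.length = p ∧ p % 2 = r ∧ mp r s = none := by
  induction w with
  | nil => simp [mp] at h
  | cons q w ih =>
    rw [mp] at h
    split at h
    · rename_i p' h1
      obtain ⟨A, s, h2, h3⟩ := ih (by rw [h1, h])
      exact ⟨q :: A, s, by simp [h2], h3⟩
    · rename_i h1
      split_ifs at h with h2
      simp at h
      exact ⟨[], w, by simp [h2.1], h, by rw [← h]; exact h2.2, h1⟩

theorem mp_one_zero {r p : ℕ} (hr : p % 2 ≠ r) : mp r (1 :: List.replicate p 0) = none := by
  simp [mp, mp_zero, hr]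

theorem sec_hit (m x r : ℕ) (hm : 3 ≤ m) (hx : x + r = 1) (A s : List (Fin 2))
    (hs : mp r s = none) (hr : s.length % 2 = r) :
    O m x (A ++ 1 :: s) = O m 2 A ∧
      S m x (A ++ 1 :: s) = S m 2 A ++ 1 :: List.replicate s.length 0 := by
  obtain ⟨h1, h2⟩ := mp_none m x r hm hx s hs
  have h3 : (x + s.length) % 2 = 1 := by omega
  have h4 : O m x (1 :: s) = 2 := by
    simp only [O, nOut, h1, h3]; simp; omega
  refine ⟨by rw [O_append, h4], ?_⟩
  rw [S_append, h4]
  simp [S, nTr, h1, h2, h3]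

theorem S2_last (m : ℕ) (A : List (Fin 2)) (hA : A ≠ []) : ∃ B, S m 2 A = B ++ [1] := by
  obtain ⟨B, q, rfl⟩ : ∃ B q, A = B ++ [q] := ⟨_, _, (List.dropLast_append_getLast hA).symm⟩
  refine ⟨S m (O m 2 [q]) B, ?_⟩
  rw [S_append]
  simp [S, O, nTr]

theorem copy (m x : ℕ) (hx : 3 ≤ x) (hxm : x < m) (w : List (Fin 2)) :
    S m x w = w ∧ O m x w = min (x + w.count 1) (m - 1) := by
  induction w with
  | nil => simp [S, O]; omega
  | cons q w ih =>
    obtain ⟨i1, i2⟩ := ih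
    rcases fin2 q with rfl | rfl
    · refine ⟨?_, ?_⟩
      · simp only [S, nTr, i1, i2]; simp; omega
      · simp only [O, nOut, i2]; simp only [↓reduceIte]; split_ifs <;> simp <;> omega
    · refine ⟨?_, ?_⟩
      · simp only [S, nTr, i1, i2]; simp; omega
      · simp only [O, nOut, i2]; simp; omega

theorem O2 (m : ℕ) (hm : 4 ≤ m) (w : List (Fin 2)) :
    O m 2 w = min (2 + w.count 1) (m - 1) := by
  induction w with
  | nil => simp [O]; omega
  | cons q w ih =>
    rcases fin2 q with rfl | rfl
    · simp only [O, nOut, ih]; simp only [↓reduceIte]; split_ifs <;> simp <;> omega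
    · simp only [O, nOut, ih]; simp; omega

theorem S2_cons (m : ℕ) (hm : 4 ≤ m) (q : Fin 2) (w : List (Fin 2)) :
    S m 2 (q :: w) = (if w.count 1 = 0 then 1 else q) :: S m 2 w := by
  rw [S, O2 m hm]
  congr 1
  rcases fin2 q with rfl | rfl <;> simp only [nTr] <;> split_ifs <;> first | rfl | omega

theorem O_small (m x : ℕ) (hm : 3 ≤ m) (w : List (Fin 2)) (h : O m x w ≤ 1) :
    S m x w = List.replicate w.length 0 := by
  by_cases hx : 2 ≤ x
  · have := ge2 m x hm hx w; omega
  · rcases h1 : mp (1 - x) w with _ | p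
    · exact (mp_none m x (1 - x) hm (by omega) w h1).2
    · obtain ⟨A, s, rfl, h2, h3, h4⟩ := mp_dec h1
      have := (sec_hit m x (1 - x) hm (by omega) A s h4 (by omega)).1
      have := ge2 m 2 hm le_rfl A
      omega

/-! ### Soundness of the invariant -/

theorem mp_two {r : ℕ} (C : List (Fin 2)) (p : ℕ) (hr : r < 2) (hp : p % 2 ≠ r) :
    mp r (C ++ [1] ++ 1 :: List.replicate p 0) = some (p + 1) := by
  have := mp_hit (r := r) C (1 :: List.replicate p 0) (mp_one_zero hp) (by simp; omega)
  simpa using this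

theorem mp_fill (m r p : ℕ) (A : List (Fin 2)) (hr : r < 2) :
    mp r (S m 2 A ++ 1 :: List.replicate p 0) =
      if p % 2 = r then some p else if A.length = 0 then none else some (p + 1) := by
  split_ifs with h1 h2
  · have := mp_hit (r := r) (S m 2 A) (List.replicate p 0) (mp_zero r p) (by simpa using h1)
    simpa using this
  · rw [List.length_eq_zero_iff] at h2
    subst h2
    exact mp_one_zero h1
  · obtain ⟨B, hB⟩ := S2_last m A (by rintro rfl; simp at h2)
    rw [hB, mp_two B p hr h1]

theorem sound0 (m x : ℕ) (hm : 3 ≤ m) (hx : x < m) (w w' : List (Fin 2))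
    (hl : w.length = w'.length) (h : key 0 w = key 0 w') :
    key 0 (S m x w) = key 0 (S m x w') ∧ min (O m x w) 2 = min (O m x w') 2 := by
  simp only [key, List.cons.injEq, and_true] at h
  by_cases hx2 : 2 ≤ x
  · refine ⟨?_, ?_⟩
    swap
    · have := ge2 m x hm hx2 w
      have := ge2 m x hm hx2 w'
      omega
    by_cases hx3 : 3 ≤ x
    · rw [(copy m x hx3 hx w).1, (copy m x hx3 hx w').1]
      simp [key, h]
    obtain rfl : x = 2 := by omega
    rcases List.eq_nil_or_concat w with rfl | ⟨A, q, rfl⟩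
    · obtain rfl : w' = [] := by
        rw [← List.length_eq_zero_iff, ← hl]; rfl
      rfl
    rcases List.eq_nil_or_concat w' with rfl | ⟨A', q', rfl⟩
    · simp at hl
    simp only [List.concat_eq_append] at *
    have hl' : A.length = A'.length := by simpa using hl
    have hz : ∀ (B : List (Fin 2)), mp 0 (B ++ [0]) ≠ some 0 := by
      intro B hB
      obtain ⟨C, s, h1, h2, -, -⟩ := mp_dec hB
      obtain rfl : s = [] := List.length_eq_zero_iff.1 h2
      have := List.append_inj_right' h1 rfl
      simp at this
    have ho : ∀ (B : List (Fin 2)), mp 0 (B ++ [1]) = some 0 := by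
      intro B
      simpa using mp_hit (r := 0) B [] rfl rfl
    have hfill : O m 2 [q] = 2 → O m 2 [q'] = 2 →
        key 0 (S m 2 (A ++ [q])) = key 0 (S m 2 (A' ++ [q'])) := by
      intro h1 h2
      have e1 : S m 2 [q] = 1 :: List.replicate 0 0 := by simp [S, O, nTr]
      have e2 : S m 2 [q'] = 1 :: List.replicate 0 0 := by simp [S, O, nTr]
      rw [S_append, S_append, h1, h2, e1, e2]
      simp only [key]
      rw [mp_fill _ _ _ _ (by omega), mp_fill _ _ _ _ (by omega), mp_fill _ _ _ _ (by omega),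
        mp_fill _ _ _ _ (by omega), hl']
    by_cases hm3 : m = 3
    · subst hm3
      apply hfill
      · rcases fin2 q with rfl | rfl <;> simp [O, nOut]
      · rcases fin2 q' with rfl | rfl <;> simp [O, nOut]
    rcases fin2 q with rfl | rfl <;> rcases fin2 q' with rfl | rfl
    · apply hfill <;> simp [O, nOut]
    · exact absurd (h.1.trans (ho A')) (hz A)
    · exact absurd (h.1.symm.trans (ho A)) (hz A')
    · have h3 : O m 2 [1] = 3 := by simp [O, nOut]; omega
      rw [S_append, S_append, h3, (copy m 3 le_rfl (by omega) A).1,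
        (copy m 3 le_rfl (by omega) A').1]
      have : S m 2 [1] = [1] := by simp [S, O, nTr]
      rw [this]
      simp [key, h]
  · have hr : mp (1 - x) w = mp (1 - x) w' := by
      rcases (show x = 0 ∨ x = 1 by omega) with rfl | rfl
      · exact h.2
      · exact h.1
    rcases h1 : mp (1 - x) w with _ | p
    · obtain ⟨a1, a2⟩ := mp_none m x (1 - x) hm (by omega) w h1
      obtain ⟨b1, b2⟩ := mp_none m x (1 - x) hm (by omega) w' (by rw [← hr, h1])
      rw [a1, a2, b1, b2, hl]; simp
    · obtain ⟨A, s, rfl, h2, h3, h4⟩ := mp_dec h1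
      obtain ⟨A', s', rfl, h2', h3', h4'⟩ := mp_dec (hr.symm.trans h1)
      obtain ⟨a1, a2⟩ := sec_hit m x (1 - x) hm (by omega) A s h4 (by omega)
      obtain ⟨b1, b2⟩ := sec_hit m x (1 - x) hm (by omega) A' s' h4' (by omega)
      have hl' : A.length = A'.length := by
        simp at hl; omega
      rw [a1, a2, b1, b2, h2, h2']
      refine ⟨?_, ?_⟩
      · simp only [key]
        rw [mp_fill _ _ _ _ (by omega), mp_fill _ _ _ _ (by omega), mp_fill _ _ _ _ (by omega),
          mp_fill _ _ _ _ (by omega), hl']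
      · have := ge2 m 2 hm le_rfl A
        have := ge2 m 2 hm le_rfl A'
        omega

theorem key_cons0 (k : ℕ) (w : List (Fin 2)) :
    key (k + 1) (0 :: w) = some 0 :: key (k + 1) w := by simp [key]

theorem key_cons1 (k : ℕ) (w : List (Fin 2)) :
    key (k + 1) (1 :: w) = some 1 :: key k w := by simp [key]

theorem mp_congr (r : ℕ) (q : Fin 2) (w w' : List (Fin 2)) (hl : w.length = w'.length)
    (h : mp r w = mp r w') : mp r (q :: w) = mp r (q :: w') := by
  simp only [mp, h, hl]

theorem key_mono (w : List (Fin 2)) : ∀ (k : ℕ) (w' : List (Fin 2)), w.length = w'.length →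
    key (k + 1) w = key (k + 1) w' → key k w = key k w' := by
  induction w with
  | nil =>
    intro k w' hl h
    obtain rfl : w' = [] := by
      rw [← List.length_eq_zero_iff, ← hl]; rfl
    rfl
  | cons q u ih =>
    intro k w' hl h
    rcases w' with _ | ⟨q', u'⟩
    · simp at hl
    have hl' : u.length = u'.length := by simpa using hl
    have hcong : ∀ q : Fin 2, key 0 u = key 0 u' → key 0 (q :: u) = key 0 (q :: u') := by
      intro q h
      simp only [key, List.cons.injEq, and_true] at h
      simp only [key]
      rw [mp_congr 0 q u u' hl' h.1, mp_congr 1 q u u' hl' h.2]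
    rcases fin2 q with rfl | rfl <;> rcases fin2 q' with rfl | rfl
    · rw [key_cons0, key_cons0] at h
      have i := ih k u' hl' (by simpa using h)
      rcases k with _ | k
      · exact hcong 0 i
      · rw [key_cons0, key_cons0, i]
    · rw [key_cons0, key_cons1] at h; simp at h
    · rw [key_cons0, key_cons1] at h; simp at h
    · rw [key_cons1, key_cons1] at h
      have i : key k u = key k u' := by simpa using h
      rcases k with _ | k
      · exact hcong 1 i
      · rw [key_cons1, key_cons1, ih k u' hl' i]

theorem sound (m x : ℕ) (hm : 3 ≤ m) (hx : x < m) (w : List (Fin 2)) :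
    ∀ (k : ℕ) (w' : List (Fin 2)), k + 3 ≤ m → w.length = w'.length → key k w = key k w' →
    key k (S m x w) = key k (S m x w') ∧ min (O m x w) (k + 2) = min (O m x w') (k + 2) := by
  induction w with
  | nil =>
    intro k w' hk hl h
    obtain rfl : w' = [] := by
      rw [← List.length_eq_zero_iff, ← hl]; rfl
    exact ⟨rfl, rfl⟩
  | cons q u ih =>
    intro k w' hk hl h
    rcases k with _ | k
    · exact sound0 m x hm hx _ _ hl h
    rcases w' with _ | ⟨q', u'⟩
    · simp at hl
    have hl' : u.length = u'.length := by simpa using hl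
    rcases fin2 q with rfl | rfl <;> rcases fin2 q' with rfl | rfl
    · rw [key_cons0, key_cons0] at h
      obtain ⟨i1, i2⟩ := ih (k + 1) u' hk hl' (by simpa using h)
      have e : nTr (O m x u') 0 = nTr (O m x u) 0 := by
        simp only [nTr, if_true]
        have : (O m x u' = 2) ↔ (O m x u = 2) := by omega
        simp only [this]
      refine ⟨?_, ?_⟩
      · simp only [S, e]
        rcases fin2 (nTr (O m x u) 0) with h0 | h0 <;> rw [h0]
        · rw [key_cons0, key_cons0, i1]
        · rw [key_cons1, key_cons1]
          rw [key_mono _ k _ (by rw [S_len, S_len, hl']) i1]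
      · simp only [O, nOut, if_true]
        split_ifs <;> omega
    · rw [key_cons0, key_cons1] at h; simp at h
    · rw [key_cons0, key_cons1] at h; simp at h
    · rw [key_cons1, key_cons1] at h
      obtain ⟨i1, i2⟩ := ih k u' (by omega) hl' (by simpa using h)
      refine ⟨?_, ?_⟩
      · by_cases h0 : O m x u = 0
        · have h0' : O m x u' = 0 := by omega
          simp only [S, h0, h0']
          rw [O_small m x hm u (by omega), O_small m x hm u' (by omega), hl']
        · have h0' : O m x u' ≠ 0 := by omega
          have e : nTr (O m x u) 1 = 1 := by simp [nTr, h0]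
          have e' : nTr (O m x u') 1 = 1 := by simp [nTr, h0']
          simp only [S, e, e']
          rw [key_cons1, key_cons1, i1]
      · have e : ∀ y, nOut m y 1 = min (y + 1) (m - 1) := by intro y; simp [nOut]
        simp only [O, e]
        omega

/-! ### Completeness of the invariant -/

theorem mp_lt {r p : ℕ} {w : List (Fin 2)} (h : mp r w = some p) : p < w.length := by
  obtain ⟨A, s, rfl, h2, -, -⟩ := mp_dec h
  simp; omega

theorem mp_tail (r : ℕ) (q q' : Fin 2) (w w' : List (Fin 2)) (hl : w.length = w'.length)
    (h : mp r (q :: w) = mp r (q' :: w')) : mp r w = mp r w' := by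
  rcases h1 : mp r w with _ | p <;> rcases h2 : mp r w' with _ | p'
  · rfl
  · have := mp_lt h2
    simp only [mp, h1, h2] at h
    split_ifs at h
    simp at h; omega
  · have := mp_lt h1
    simp only [mp, h1, h2] at h
    split_ifs at h
    simp at h; omega
  · simpa only [mp, h1, h2] using h

theorem key0_tail (q q' : Fin 2) (w w' : List (Fin 2)) (hl : w.length = w'.length)
    (h : key 0 (q :: w) = key 0 (q' :: w')) : key 0 w = key 0 w' := by
  simp only [key, List.cons.injEq, and_true] at h ⊢
  exact ⟨mp_tail 0 q q' w w' hl h.1, mp_tail 1 q q' w w' hl h.2⟩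

theorem count_zero (A : List (Fin 2)) (h : A.count 1 = 0) : A = List.replicate A.length 0 := by
  rw [List.eq_replicate_iff]
  refine ⟨rfl, fun b hb => ?_⟩
  rcases fin2 b with rfl | rfl
  · rfl
  · exact absurd hb (List.count_eq_zero.1 h)

theorem fill_lemma (m : ℕ) (hm : 4 ≤ m) (c d : List (Fin 2)) (A : List (Fin 2)) :
    ∀ (k : ℕ) (A' : List (Fin 2)), A.length = A'.length →
    key 0 (A ++ d) = key 0 (A' ++ d) → key k (S m 2 A ++ c) = key k (S m 2 A' ++ c) →
    min (A.count 1) k = min (A'.count 1) k → key k (A ++ d) = key k (A' ++ d) := by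
  induction A with
  | nil =>
    intro k A' hl _ _ _
    obtain rfl : A' = [] := by
      rw [← List.length_eq_zero_iff, ← hl]; rfl
    rfl
  | cons q B ih =>
    intro k A' hl h0 hk hc
    rcases k with _ | k
    · exact h0
    rcases A' with _ | ⟨q', B'⟩
    · simp at hl
    have hl' : B.length = B'.length := by simpa using hl
    have h0' : key 0 (B ++ d) = key 0 (B' ++ d) := key0_tail q q' _ _ (by simp [hl']) h0
    rw [S2_cons m hm, S2_cons m hm] at hk
    simp only [List.cons_append] at hk ⊢
    rcases fin2 q with rfl | rfl <;> rcases fin2 q' with rfl | rfl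
    · simp at hc
      by_cases hB : B.count 1 = 0
      · have hB' : B'.count 1 = 0 := by omega
        rw [count_zero B hB, count_zero B' hB', hl']
      · have hB' : B'.count 1 ≠ 0 := by omega
        rw [if_neg hB, if_neg hB', key_cons0, key_cons0] at hk
        rw [key_cons0, key_cons0, ih (k + 1) B' hl' h0' (by simpa using hk) (by omega)]
    · simp at hc
      have hB : B.count 1 ≠ 0 := by omega
      rw [if_neg hB, ite_self, key_cons0, key_cons1] at hk
      simp at hk
    · simp at hc
      have hB' : B'.count 1 ≠ 0 := by omega
      rw [if_neg hB', ite_self, key_cons0, key_cons1] at hk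
      simp at hk
    · simp at hc
      rw [ite_self, ite_self, key_cons1, key_cons1] at hk
      rw [key_cons1, key_cons1, ih k B' hl' h0' (by simpa using hk) (by omega)]

/-- A bisimulation. -/
def Bisim (m : ℕ) (R : List (Fin 2) → List (Fin 2) → Prop) : Prop :=
  ∀ w w', R w w' → ∀ x, x < m → O m x w = O m x w' ∧ R (S m x w) (S m x w')

theorem S2_shape (m : ℕ) (A : List (Fin 2)) : S m 2 A = [] ∨ ∃ B, S m 2 A = B ++ [1] := by
  by_cases hA : A = []
  · left; subst hA; rfl
  · right; exact S2_last m A hA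

theorem sweep (m : ℕ) (hm : 3 ≤ m) (R : List (Fin 2) → List (Fin 2) → Prop) (hR : Bisim m R)
    (n : ℕ) : ∀ (C C' : List (Fin 2)) (p p' : ℕ), C.length = n →
    (C = [] ∨ ∃ B, C = B ++ [1]) → (C' = [] ∨ ∃ B, C' = B ++ [1]) → p % 2 = p' % 2 →
    C.length + p = C'.length + p' →
    R (C ++ 1 :: List.replicate p 0) (C' ++ 1 :: List.replicate p' 0) → p = p' := by
  induction n with
  | zero =>
    intro C C' p p' hn hC hC' hp hl h
    obtain rfl := List.length_eq_zero_iff.1 hn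
    rcases hC' with rfl | ⟨B', rfl⟩
    · simpa using hl
    · exfalso
      obtain ⟨x, r, hx, hr⟩ : ∃ x r, x + r = 1 ∧ r = (p + 1) % 2 :=
        ⟨1 - (p + 1) % 2, (p + 1) % 2, by omega, rfl⟩
      have h1 := (hR _ _ h x (by omega)).1
      have h2 := (mp_none m x r hm hx (1 :: List.replicate p 0) (mp_one_zero (by omega))).1
      have h3 := (sec_hit m x r hm hx B' (1 :: List.replicate p' 0) (mp_one_zero (by omega))
        (by simp; omega)).1
      have h4 := ge2 m 2 hm le_rfl B'
      simp only [List.append_assoc, List.cons_append, List.nil_append] at h1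
      omega
  | succ n ih =>
    intro C C' p p' hn hC hC' hp hl h
    obtain ⟨x, r, hx, hr⟩ : ∃ x r, x + r = 1 ∧ r = (p + 1) % 2 :=
      ⟨1 - (p + 1) % 2, (p + 1) % 2, by omega, rfl⟩
    rcases hC with rfl | ⟨B, rfl⟩
    · simp at hn
    obtain ⟨h1, h5⟩ := hR _ _ h x (by omega)
    obtain ⟨h3, h6⟩ := sec_hit m x r hm hx B (1 :: List.replicate p 0) (mp_one_zero (by omega))
        (by simp; omega)
    have h4 := ge2 m 2 hm le_rfl B
    simp only [List.append_assoc, List.cons_append, List.nil_append] at h1 h5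
    rcases hC' with rfl | ⟨B', rfl⟩
    · have h2 := (mp_none m x r hm hx (1 :: List.replicate p' 0) (mp_one_zero (by omega))).1
      simp only [List.nil_append] at h1
      omega
    obtain ⟨h3', h6'⟩ := sec_hit m x r hm hx B' (1 :: List.replicate p' 0)
        (mp_one_zero (by omega)) (by simp; omega)
    simp only [List.append_assoc, List.cons_append, List.nil_append] at h1 h5
    rw [h6, h6'] at h5
    simp only [List.length_cons, List.length_replicate] at h5
    have := ih (S m 2 B) (S m 2 B') (p + 1) (p' + 1) (by rw [S_len]; simpa using hn)
      (S2_shape m B) (S2_shape m B') (by omega)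
      (by rw [S_len, S_len]; simp at hl; omega) h5
    omega

theorem complete_mp (m : ℕ) (hm : 3 ≤ m) (R : List (Fin 2) → List (Fin 2) → Prop)
    (hR : Bisim m R) (w w' : List (Fin 2)) (hl : w.length = w'.length) (h : R w w')
    (x r : ℕ) (hx : x + r = 1) : mp r w = mp r w' := by
  obtain ⟨h1, h5⟩ := hR _ _ h x (by omega)
  rcases e : mp r w with _ | p <;> rcases e' : mp r w' with _ | p'
  · rfl
  · exfalso
    obtain ⟨A', s', rfl, h2', h3', h4'⟩ := mp_dec e'
    have h6 := (sec_hit m x r hm hx A' s' h4' (by omega)).1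
    have h7 := (mp_none m x r hm hx w e).1
    have := ge2 m 2 hm le_rfl A'
    omega
  · exfalso
    obtain ⟨A', s', rfl, h2', h3', h4'⟩ := mp_dec e
    have h6 := (sec_hit m x r hm hx A' s' h4' (by omega)).1
    have h7 := (mp_none m x r hm hx w' e').1
    have := ge2 m 2 hm le_rfl A'
    omega
  · obtain ⟨A, s, rfl, h2, h3, h4⟩ := mp_dec e
    obtain ⟨A', s', rfl, h2', h3', h4'⟩ := mp_dec e'
    rw [(sec_hit m x r hm hx A s h4 (by omega)).2,
      (sec_hit m x r hm hx A' s' h4' (by omega)).2, h2, h2'] at h5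
    congr 1
    refine sweep m hm R hR _ _ _ p p' rfl (S2_shape m A) (S2_shape m A') (by omega) ?_ h5
    rw [S_len, S_len]
    simp at hl
    omega

theorem complete0 (m : ℕ) (hm : 3 ≤ m) (R : List (Fin 2) → List (Fin 2) → Prop)
    (hR : Bisim m R) (w w' : List (Fin 2)) (hl : w.length = w'.length) (h : R w w') :
    key 0 w = key 0 w' := by
  simp only [key]
  rw [complete_mp m hm R hR w w' hl h 1 0 rfl, complete_mp m hm R hR w w' hl h 0 1 rfl]

/-- One step of the reconstruction: from the section back to the word. -/
theorem step_back (m k : ℕ) (hm : m = k + 4) (R : List (Fin 2) → List (Fin 2) → Prop)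
    (hR : Bisim m R) (A A' s : List (Fin 2)) (r : ℕ) (hr2 : r < 2) (hs : mp r s = none)
    (hr : s.length % 2 = r) (hl : A.length = A'.length) (h : R (A ++ 1 :: s) (A' ++ 1 :: s))
    (ih : R (S m 2 A ++ 1 :: List.replicate s.length 0)
      (S m 2 A' ++ 1 :: List.replicate s.length 0) →
      key (k + 1) (S m 2 A ++ 1 :: List.replicate s.length 0) =
      key (k + 1) (S m 2 A' ++ 1 :: List.replicate s.length 0)) :
    key (k + 1) (A ++ 1 :: s) = key (k + 1) (A' ++ 1 :: s) := by
  obtain ⟨h1, h5⟩ := hR _ _ h (1 - r) (by omega)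
  obtain ⟨a1, a2⟩ := sec_hit m (1 - r) r (by omega) (by omega) A s hs hr
  obtain ⟨b1, b2⟩ := sec_hit m (1 - r) r (by omega) (by omega) A' s hs hr
  rw [a2, b2] at h5
  rw [a1, b1, O2 m (by omega), O2 m (by omega)] at h1
  refine fill_lemma m (by omega) (1 :: List.replicate s.length 0) (1 :: s) A (k + 1) A' hl
    (complete0 m (by omega) R hR _ _ (by simp [hl]) h) (ih h5) (by omega)

theorem complete1 (m k : ℕ) (hm : m = k + 4) (R : List (Fin 2) → List (Fin 2) → Prop)
    (hR : Bisim m R) (n : ℕ) : ∀ (C C' : List (Fin 2)) (p : ℕ), C.length = n →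
    (C = [] ∨ ∃ B, C = B ++ [1]) → (C' = [] ∨ ∃ B, C' = B ++ [1]) →
    C.length = C'.length →
    R (C ++ 1 :: List.replicate p 0) (C' ++ 1 :: List.replicate p 0) →
    key (k + 1) (C ++ 1 :: List.replicate p 0) = key (k + 1) (C' ++ 1 :: List.replicate p 0) := by
  induction n with
  | zero =>
    intro C C' p hn _ _ hl _
    obtain rfl := List.length_eq_zero_iff.1 hn
    obtain rfl := List.length_eq_zero_iff.1 (hl.symm.trans hn)
    rfl
  | succ n ih =>
    intro C C' p hn hC hC' hl h
    rcases hC with rfl | ⟨B, rfl⟩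
    · simp at hn
    rcases hC' with rfl | ⟨B', rfl⟩
    · simp at hl
    simp only [List.append_assoc, List.cons_append, List.nil_append] at h ⊢
    have hl' : B.length = B'.length := by simpa using hl
    refine step_back m k hm R hR B B' (1 :: List.replicate p 0) ((p + 1) % 2) (by omega)
      (mp_one_zero (by omega)) (by simp) hl' h ?_
    intro h'
    exact ih _ _ _ (by rw [S_len]; simpa using hn) (S2_shape m B) (S2_shape m B')
      (by rw [S_len, S_len, hl']) h'

/-- Decomposition at the rightmost state `1`. -/
theorem first_one (w : List (Fin 2)) :
    w = List.replicate w.length 0 ∨ ∃ A b, w = A ++ 1 :: List.replicate b 0 := by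
  induction w with
  | nil => left; rfl
  | cons q w ih =>
    rcases ih with h | ⟨A, b, h⟩
    · rcases fin2 q with rfl | rfl
      · left; rw [List.length_cons, List.replicate_succ, ← h]
      · right; exact ⟨[], w.length, by rw [List.nil_append, ← h]⟩
    · right; exact ⟨q :: A, b, by rw [h]; rfl⟩

theorem key0_first (A A' : List (Fin 2)) (b b' : ℕ) (hb : b < b')
    (h : key 0 (A ++ 1 :: List.replicate b 0) = key 0 (A' ++ 1 :: List.replicate b' 0)) :
    False := by
  have e : mp (b % 2) (A ++ 1 :: List.replicate b 0) =
      mp (b % 2) (A' ++ 1 :: List.replicate b' 0) := by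
    simp only [key, List.cons.injEq, and_true] at h
    rcases Nat.mod_two_eq_zero_or_one b with h2 | h2 <;> rw [h2]
    · exact h.1
    · exact h.2
  rw [mp_hit A _ (mp_zero _ _) (by simp)] at e
  obtain ⟨B, s, h1, h2, h3, h4⟩ := mp_dec e.symm
  simp at h2
  have h5 : A' ++ 1 :: List.replicate b' 0 =
      (A' ++ 1 :: List.replicate (b' - (b + 1)) 0) ++ List.replicate (b + 1) 0 := by
    simp; omega
  have h6 : B ++ 1 :: s = B ++ (1 :: s) := rfl
  rw [h5] at h1
  have := List.append_inj_right' h1 (by simp [h2])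
  simp [List.replicate_succ] at this

theorem complete (m k : ℕ) (hm : m = k + 3) (R : List (Fin 2) → List (Fin 2) → Prop)
    (hR : Bisim m R) (w w' : List (Fin 2)) (hl : w.length = w'.length) (h : R w w') :
    key k w = key k w' := by
  have h0 := complete0 m (by omega) R hR w w' hl h
  rcases k with _ | k
  · exact h0
  have hnone : ∀ (n : ℕ) (A : List (Fin 2)) (b : ℕ),
      key 0 (List.replicate n 0) ≠ key 0 (A ++ 1 :: List.replicate b 0) := by
    intro n A b hh
    simp only [key, List.cons.injEq, and_true, mp_zero] at hh
    have := mp_hit (r := b % 2) A _ (mp_zero _ b) (by simp)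
    rcases Nat.mod_two_eq_zero_or_one b with h2 | h2 <;> rw [h2] at this
    · rw [← hh.1] at this; simp at this
    · rw [← hh.2] at this; simp at this
  rcases first_one w with e | ⟨A, b, e⟩ <;> rcases first_one w' with e' | ⟨A', b', e'⟩
  · rw [e, e', hl]
  · rw [e, e'] at h0; exact absurd h0 (hnone _ _ _)
  · rw [e, e'] at h0; exact absurd h0.symm (hnone _ _ _)
  · subst e e'
    obtain rfl : b = b' := by
      rcases lt_trichotomy b b' with hb | hb | hb
      · exact (key0_first _ _ _ _ hb h0).elim
      · exact hb
      · exact (key0_first _ _ _ _ hb h0.symm).elim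
    have hl' : A.length = A'.length := by simpa using hl
    refine step_back m k hm R hR A A' (List.replicate b 0) (b % 2) (by omega)
      (mp_zero _ _) (by simp) hl' h ?_
    intro h'
    exact complete1 m k hm R hR _ _ _ _ rfl (S2_shape m A) (S2_shape m A')
      (by rw [S_len, S_len, hl']) h'

/-! ### Bridge to the automatic transformations -/

theorem bmOut_val (m : ℕ) (hm : 3 ≤ m) (x : Fin m) (q : Fin 2) :
    (bmOut m x q : ℕ) = nOut m x q := by
  unfold bmOut nOut
  split_ifs
  · exact Nat.mod_eq_of_lt (by omega)
  · rfl
  · rfl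
  · rfl

theorem bmTr_eq (m : ℕ) (x : Fin m) (q : Fin 2) : bmTr m x q = nTr x q := rfl

/-- The shift of an infinite word. -/
def sh {X : Type*} (u : ℕ → X) : ℕ → X := fun n => u (n + 1)

theorem stateSeq_sh {X Q : Type*} (tr : X → Q → Q) (q : Q) (u : ℕ → X) (n : ℕ) :
    stateSeq tr q u (n + 1) = stateSeq tr (tr (u 0) q) (sh u) n := by
  induction n with
  | zero => rfl
  | succ n ih => rw [stateSeq, ih]; rfl

theorem autTrans_sh {X Q : Type*} (tr : X → Q → Q) (out : X → Q → X) (q : Q) (u : ℕ → X) :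
    sh (autTrans tr out q u) = autTrans tr out (tr (u 0) q) (sh u) := by
  funext n
  simp only [sh, autTrans, stateSeq_sh]

/-- The transformation of a word of states for `B_m`. -/
abbrev T (m : ℕ) (w : List (Fin 2)) : (ℕ → Fin m) → (ℕ → Fin m) :=
  wordTrans (bmTr m) (bmOut m) w

theorem T_cons (m : ℕ) (q : Fin 2) (w : List (Fin 2)) (u : ℕ → Fin m) :
    T m (q :: w) u = autTrans (bmTr m) (bmOut m) q (T m w u) := rfl

theorem T_zero (m : ℕ) (hm : 3 ≤ m) (w : List (Fin 2)) (u : ℕ → Fin m) :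
    (T m w u 0 : ℕ) = O m (u 0) w := by
  induction w with
  | nil => rfl
  | cons q w ih =>
    rw [T_cons, O, ← ih, ← bmOut_val m hm]
    rfl

theorem T_sh (m : ℕ) (hm : 3 ≤ m) (w : List (Fin 2)) (u : ℕ → Fin m) :
    sh (T m w u) = T m (S m (u 0) w) (sh u) := by
  induction w with
  | nil => rfl
  | cons q w ih =>
    rw [T_cons, autTrans_sh, S, T_cons, ih, bmTr_eq, T_zero m hm]

theorem T_bisim (m : ℕ) (hm : 3 ≤ m) : Bisim m (fun w w' => T m w = T m w') := by
  intro w w' h x hx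
  refine ⟨?_, ?_⟩
  · have h1 := T_zero m hm w (fun _ => ⟨x, hx⟩)
    have h2 := T_zero m hm w' (fun _ => ⟨x, hx⟩)
    simp only at h h1 h2
    rw [← h1, ← h2, h]
  · funext u
    let v : ℕ → Fin m := fun n => Nat.casesOn n ⟨x, hx⟩ u
    have h1 := T_sh m hm w v
    have h2 := T_sh m hm w' v
    rw [h, h2] at h1
    exact h1.symm

theorem T_sound (m k : ℕ) (hm : m = k + 3) (n : ℕ) : ∀ (w w' : List (Fin 2)) (u : ℕ → Fin m),
    w.length = w'.length → key k w = key k w' → T m w u n = T m w' u n := by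
  induction n with
  | zero =>
    intro w w' u hl h
    apply Fin.ext
    rw [T_zero m (by omega), T_zero m (by omega)]
    have h1 := (sound m (u 0) (by omega) (u 0).2 w k w' (by omega) hl h).2
    have h2 := O_lt m (u 0) (by omega) (u 0).2 w
    have h3 := O_lt m (u 0) (by omega) (u 0).2 w'
    omega
  | succ n ih =>
    intro w w' u hl h
    change sh (T m w u) n = sh (T m w' u) n
    rw [T_sh m (by omega), T_sh m (by omega)]
    exact ih _ _ _ (by rw [S_len, S_len, hl])
      (sound m (u 0) (by omega) (u 0).2 w k w' (by omega) hl h).1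

theorem T_iff (m k : ℕ) (hm : m = k + 3) (w w' : List (Fin 2)) (hl : w.length = w'.length) :
    T m w = T m w' ↔ key k w = key k w' := by
  constructor
  · intro h
    exact complete m k hm _ (T_bisim m (by omega)) w w' hl h
  · intro h
    funext u n
    exact T_sound m k hm n w w' u hl h

/-! ### Counting -/

/-- The words of length `n`. -/
def W (n : ℕ) : Set (List (Fin 2)) := {w | w.length = n}

/-- The values of the invariant on words of length `n`. -/
def I (k n : ℕ) : Set (List (Option ℕ)) := key k '' W n

theorem W_fin (n : ℕ) : (W n).Finite := List.finite_length_eq (Fin 2) n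

theorem growth_eq (m k : ℕ) (hm : m = k + 3) (n : ℕ) :
    growth (bmTr m) (bmOut m) n = (I k n).ncard := by
  have h1 : {g : (ℕ → Fin m) → (ℕ → Fin m) |
      ∃ w : List (Fin 2), w.length = n ∧ wordTrans (bmTr m) (bmOut m) w = g} =
      T m '' W n := rfl
  unfold growth
  rw [h1]
  have hc : ∀ c ∈ I k n, ∃ w, w.length = n ∧ key k w = c := fun c hc => hc
  choose! φ hφ using hc
  have h2 : T m '' W n = (fun c => T m (φ c)) '' I k n := by
    ext g
    constructor
    · rintro ⟨w, hw, rfl⟩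
      have hmem : key k w ∈ I k n := ⟨w, hw, rfl⟩
      refine ⟨key k w, hmem, ?_⟩
      obtain ⟨a, b⟩ := hφ _ hmem
      exact (T_iff m k hm _ _ (a.trans (Eq.symm hw))).2 b
    · rintro ⟨c, hc, rfl⟩
      exact ⟨φ c, (hφ c hc).1, rfl⟩
  rw [h2]
  apply Set.InjOn.ncard_image
  intro c hc c' hc' h
  obtain ⟨a, b⟩ := hφ _ hc
  obtain ⟨a', b'⟩ := hφ _ hc'
  rw [← b, ← b']
  exact (T_iff m k hm _ _ (a.trans a'.symm)).1 h

theorem I_fin (k n : ℕ) : (I k n).Finite := (W_fin n).image _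

theorem I_succ (k n : ℕ) : (I (k + 1) (n + 1)).ncard = (I (k + 1) n).ncard + (I k n).ncard := by
  have h : I (k + 1) (n + 1) =
      (fun l => some 0 :: l) '' I (k + 1) n ∪ (fun l => some 1 :: l) '' I k n := by
    ext c
    constructor
    · rintro ⟨w, hw, rfl⟩
      rcases w with _ | ⟨q, w⟩
      · simp [W] at hw
      have hw' : w ∈ W n := by simpa [W] using hw
      rcases fin2 q with rfl | rfl
      · left; exact ⟨key (k + 1) w, ⟨w, hw', rfl⟩, (key_cons0 k w).symm⟩
      · right; exact ⟨key k w, ⟨w, hw', rfl⟩, (key_cons1 k w).symm⟩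
    · rintro (⟨_, ⟨w, hw, rfl⟩, rfl⟩ | ⟨_, ⟨w, hw, rfl⟩, rfl⟩)
      · exact ⟨0 :: w, by simpa [W] using hw, key_cons0 k w⟩
      · exact ⟨1 :: w, by simpa [W] using hw, key_cons1 k w⟩
  rw [h, Set.ncard_union_eq _ ((I_fin _ _).image _) ((I_fin _ _).image _),
    Set.ncard_image_of_injective _ (by intro a b h; simpa using h),
    Set.ncard_image_of_injective _ (by intro a b h; simpa using h)]
  rw [Set.disjoint_left]
  rintro _ ⟨l, -, rfl⟩ ⟨l', -, h⟩
  simp at h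

/-- The possible values of `mp r` on words of length `n`. -/
def V (r : ℕ) : ℕ → Finset (Option ℕ)
  | 0 => {none}
  | n + 1 => if n % 2 = r then insert (some n) (V r n) else V r n

theorem V_none (r n : ℕ) : none ∈ V r n := by
  induction n with
  | zero => simp [V]
  | succ n ih => rw [V]; split_ifs <;> simp [ih]

theorem V_lt (r n p : ℕ) (h : some p ∈ V r n) : p < n := by
  induction n with
  | zero => simp [V] at h
  | succ n ih =>
    rw [V] at h
    split_ifs at h
    · rcases Finset.mem_insert.1 h with h | h
      · simp at h; omega
      · have := ih h; omega
    · have := ih h; omega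

theorem V_card (n : ℕ) : (V 0 n).card = (n + 1) / 2 + 1 ∧ (V 1 n).card = n / 2 + 1 := by
  induction n with
  | zero => simp [V]
  | succ n ih =>
    have h : ∀ r, some n ∉ V r n := fun r h => by have := V_lt r n n h; omega
    simp only [V]
    rcases Nat.mod_two_eq_zero_or_one n with h2 | h2
    · rw [if_pos h2, if_neg (by omega), Finset.card_insert_of_notMem (h 0)]
      omega
    · rw [if_pos h2, if_neg (by omega), Finset.card_insert_of_notMem (h 1)]
      omega

theorem mp_cons0 (r : ℕ) (w : List (Fin 2)) : mp r (0 :: w) = mp r w := by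
  rw [mp]; rcases mp r w with _ | p <;> simp

theorem mp_cons_ne (r : ℕ) (q : Fin 2) (w : List (Fin 2)) (h : w.length % 2 ≠ r) :
    mp r (q :: w) = mp r w := by
  rw [mp]; rcases mp r w with _ | p <;> simp [h]

theorem mp_mem (r : ℕ) (w : List (Fin 2)) : mp r w ∈ V r w.length := by
  induction w with
  | nil => simp [mp, V]
  | cons q w ih =>
    rw [List.length_cons, V]
    rcases fin2 q with rfl | rfl
    · rw [mp_cons0]
      split_ifs
      · exact Finset.mem_insert_of_mem ih
      · exact ih
    · split_ifs with h1
      · rcases h : mp r w with _ | p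
        · simp [mp, h, h1]
        · rw [h] at ih
          simp only [mp, h]
          exact Finset.mem_insert_of_mem ih
      · rw [mp_cons_ne _ _ _ h1]
        exact ih

theorem mp_surj (n : ℕ) : ∀ a ∈ V 0 n, ∀ b ∈ V 1 n,
    ∃ w : List (Fin 2), w.length = n ∧ mp 0 w = a ∧ mp 1 w = b := by
  induction n with
  | zero =>
    intro a ha b hb
    simp [V] at ha hb
    exact ⟨[], rfl, by simp [mp, ha], by simp [mp, hb]⟩
  | succ n ih =>
    intro a ha b hb
    have hold : a ∈ V 0 n → b ∈ V 1 n →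
        ∃ w : List (Fin 2), w.length = n + 1 ∧ mp 0 w = a ∧ mp 1 w = b := by
      intro ha hb
      obtain ⟨w, h1, h2, h3⟩ := ih a ha b hb
      exact ⟨0 :: w, by simp [h1], by rw [mp_cons0, h2], by rw [mp_cons0, h3]⟩
    rw [V] at ha hb
    rcases Nat.mod_two_eq_zero_or_one n with h2 | h2
    · rw [if_pos h2] at ha
      rw [if_neg (by omega)] at hb
      rcases Finset.mem_insert.1 ha with rfl | ha
      · obtain ⟨w, h1, h4, h3⟩ := ih none (V_none _ _) b hb
        refine ⟨1 :: w, by simp [h1], ?_, ?_⟩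
        · rw [mp, h4]; simp [h1, h2]
        · rw [mp_cons_ne _ _ _ (by omega), h3]
      · exact hold ha hb
    · rw [if_pos h2] at hb
      rw [if_neg (by omega)] at ha
      rcases Finset.mem_insert.1 hb with rfl | hb
      · obtain ⟨w, h1, h4, h3⟩ := ih a ha none (V_none _ _)
        refine ⟨1 :: w, by simp [h1], ?_, ?_⟩
        · rw [mp_cons_ne _ _ _ (by omega), h4]
        · rw [mp, h3]; simp [h1, h2]
      · exact hold ha hb

theorem I_zero (n : ℕ) : (I 0 n).ncard = ((n + 1) / 2 + 1) * (n / 2 + 1) := by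
  have h : I 0 n = (fun c : Option ℕ × Option ℕ => [c.1, c.2]) '' (V 0 n ×ˢ V 1 n : Finset _) := by
    ext c
    constructor
    · rintro ⟨w, hw, rfl⟩
      have hw' : w.length = n := hw
      exact ⟨(mp 0 w, mp 1 w), by simp [← hw', mp_mem], by simp [key]⟩
    · rintro ⟨⟨a, b⟩, hc, rfl⟩
      simp at hc
      obtain ⟨w, h1, h2, h3⟩ := mp_surj n a hc.1 b hc.2
      exact ⟨w, h1, by simp [key, h2, h3]⟩
  rw [h, Set.ncard_image_of_injective, Set.ncard_coe_finset, Finset.card_product,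
    (V_card n).1, (V_card n).2]
  rintro ⟨a, b⟩ ⟨c, d⟩ h
  simpa using h

theorem fdiff_step (k : ℕ) (i : ℕ) : ∀ n, i + 1 ≤ n →
    fdiff (fun j => ((I (k + 1) j).ncard : ℤ)) (i + 1) n =
      fdiff (fun j => ((I k j).ncard : ℤ)) i (n - 1) := by
  induction i with
  | zero =>
    intro n hn
    obtain ⟨n, rfl⟩ : ∃ j, n = j + 1 := ⟨n - 1, by omega⟩
    simp [fdiff, I_succ]
  | succ i ih =>
    intro n hn
    rw [fdiff, ih n (by omega), ih (n - 1) (by omega), fdiff]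

theorem fdiff_I (k : ℕ) : ∀ n, k + 2 ≤ n →
    fdiff (fun j => ((I k j).ncard : ℤ)) (k + 1) n = (((n - (k + 2)) / 2 + 2 : ℕ) : ℤ) := by
  induction k with
  | zero =>
    intro n hn
    simp only [fdiff, I_zero]
    obtain ⟨j, hj | hj⟩ : ∃ j, n = 2 * j + 2 ∨ n = 2 * j + 3 := ⟨(n - 2) / 2, by omega⟩ <;>
      subst hj
    · rw [show (2 * j + 2 + 1) / 2 = j + 1 by omega, show (2 * j + 2) / 2 = j + 1 by omega,
        show (2 * j + 2 - 1 + 1) / 2 = j + 1 by omega, show (2 * j + 2 - 1) / 2 = j by omega,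
        show (2 * j + 2 - (0 + 2)) / 2 = j by omega]
      push_cast; ring
    · rw [show (2 * j + 3 + 1) / 2 = j + 2 by omega, show (2 * j + 3) / 2 = j + 1 by omega,
        show (2 * j + 3 - 1 + 1) / 2 = j + 1 by omega, show (2 * j + 3 - 1) / 2 = j + 1 by omega,
        show (2 * j + 3 - (0 + 2)) / 2 = j by omega]
      push_cast; ring
  | succ k ih =>
    intro n hn
    rw [fdiff_step k (k + 1) n (by omega), ih (n - 1) (by omega),
      show n - 1 - (k + 2) = n - (k + 1 + 2) by omega]

end BM

/-- For every `m ≥ 3` and `n ≥ m−1`, the `(m−2)`-th finite difference of the growth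
function `γ` of the automaton `B_m` satisfies `γ^(m−2)(n) = ⌊(n−m+1)/2⌋ + 2`. -/
theorem fdiff_bm (m : ℕ) (hm : 3 ≤ m) (n : ℕ) (hn : m - 1 ≤ n) :
    fdiff (fun k => (growth (bmTr m) (bmOut m) k : ℤ)) (m - 2) n =
      (((n - (m - 1)) / 2 + 2 : ℕ) : ℤ) := by
  obtain ⟨k, rfl⟩ : ∃ k, m = k + 3 := ⟨m - 3, by omega⟩
  have h : (fun j => (growth (bmTr (k + 3)) (bmOut (k + 3)) j : ℤ)) =
      fun j => ((BM.I k j).ncard : ℤ) := by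
    funext j
    rw [BM.growth_eq (k + 3) k rfl j]
  rw [h]
  exact BM.fdiff_I k n (by omega)
end

section
/- Let m ≥ 4 and let γ_{B_m} and γ_{B_{m−1}} be the growth functions of the Mealy automata B_m and B_{m−1}. Then for every integer n ≥ 2, γ_{B_m}(n) − γ_{B_m}(n−1) = γ_{B_{m−1}}(n−1); that is, the first finite difference of the growth function of B_m coincides with the growth function of B_{m−1} shifted by one. -/
namespace BmAux

/-! ### A model of the automaton with natural-number letters -/

/-- Output on natural-number letters. -/
def o (m x : ℕ) (q : Fin 2) : ℕ :=
  if q = 0 then (if x = 0 then 1 else if x = 1 then 0 else x) else min (x + 1) (m - 1)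

/-- Transition on natural-number letters. -/
def t (x : ℕ) (q : Fin 2) : Fin 2 :=
  if q = 0 then (if x = 2 then 1 else 0) else (if x = 0 then 0 else 1)

/-- Output letter of a word of states. -/
def wo (m : ℕ) : List (Fin 2) → ℕ → ℕ
  | [], x => x
  | q :: w, x => o m (wo m w x) q

/-- Section of a word of states at a letter. -/
def ws (m : ℕ) : List (Fin 2) → ℕ → List (Fin 2)
  | [], _ => []
  | q :: w, x => t (wo m w x) q :: ws m w x

/-- Equivalence of words of states, as a bisimilarity. -/
def E (m : ℕ) (w v : List (Fin 2)) : Prop :=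
  ∃ R : List (Fin 2) → List (Fin 2) → Prop, R w v ∧
    ∀ w v, R w v → ∀ x < m, wo m w x = wo m v x ∧ R (ws m w x) (ws m v x)

theorem fin2 (q : Fin 2) : q = 0 ∨ q = 1 := by omega

theorem E.step {m w v} (h : E m w v) {x} (hx : x < m) :
    wo m w x = wo m v x ∧ E m (ws m w x) (ws m v x) := by
  obtain ⟨R, h1, h2⟩ := h
  exact ⟨(h2 _ _ h1 x hx).1, R, (h2 _ _ h1 x hx).2, h2⟩

theorem E.refl (m w) : E m w w :=
  ⟨fun a b => a = b, rfl, by rintro a b rfl x _; exact ⟨rfl, rfl⟩⟩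

theorem E.symm {m w v} (h : E m w v) : E m v w := by
  obtain ⟨R, h1, h2⟩ := h
  exact ⟨fun a b => R b a, h1, fun a b h x hx => ⟨(h2 _ _ h x hx).1.symm, (h2 _ _ h x hx).2⟩⟩

theorem E.trans {m a b c} (h : E m a b) (h' : E m b c) : E m a c := by
  refine ⟨fun a c => ∃ b, E m a b ∧ E m b c, ⟨b, h, h'⟩, ?_⟩
  rintro a c ⟨b, h, h'⟩ x hx
  exact ⟨(h.step hx).1.trans (h'.step hx).1, _, (h.step hx).2, (h'.step hx).2⟩

theorem E.of_step {m w v} (h : ∀ x < m, wo m w x = wo m v x ∧ E m (ws m w x) (ws m v x)) :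
    E m w v := by
  refine ⟨fun a b => E m a b ∨ (a = w ∧ b = v), Or.inr ⟨rfl, rfl⟩, ?_⟩
  rintro a b (h' | ⟨rfl, rfl⟩) x hx
  · exact ⟨(h'.step hx).1, Or.inl (h'.step hx).2⟩
  · exact ⟨(h x hx).1, Or.inl (h x hx).2⟩

@[simp] theorem length_ws (m w x) : (ws m w x).length = w.length := by
  induction w with
  | nil => rfl
  | cons q w ih => simp [ws, ih]

theorem wo_append (m a b x) : wo m (a ++ b) x = wo m a (wo m b x) := by
  induction a with
  | nil => rfl
  | cons q w ih => simp [wo, ih]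

theorem ws_append (m a b x) : ws m (a ++ b) x = ws m a (wo m b x) ++ ws m b x := by
  induction a with
  | nil => rfl
  | cons q w ih => simp [ws, ih, wo_append]

theorem o_lt {m x : ℕ} (hm : 2 ≤ m) (hx : x < m) (q) : o m x q < m := by
  unfold o; split_ifs <;> omega

theorem wo_lt {m x : ℕ} (hm : 2 ≤ m) (hx : x < m) (w) : wo m w x < m := by
  induction w with
  | nil => exact hx
  | cons q w ih => exact o_lt hm ih q

theorem E.append_right {m u v} (hm : 2 ≤ m) (h : E m u v) (c) : E m (u ++ c) (v ++ c) := by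
  refine ⟨fun a b => ∃ u v c, a = u ++ c ∧ b = v ++ c ∧ E m u v, ⟨u, v, c, rfl, rfl, h⟩, ?_⟩
  rintro a b ⟨u, v, c, rfl, rfl, h⟩ x hx
  have := h.step (wo_lt hm hx c)
  exact ⟨by simp [wo_append, this.1], _, _, _, ws_append .., ws_append .., this.2⟩

theorem E.cons {m u v} (h : E m u v) (q) : E m (q :: u) (q :: v) := by
  refine ⟨fun a b => ∃ u v q, a = q :: u ∧ b = q :: v ∧ E m u v, ⟨u, v, q, rfl, rfl, h⟩, ?_⟩
  rintro a b ⟨u, v, q, rfl, rfl, h⟩ x hx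
  have := h.step hx
  exact ⟨by simp [wo, this.1], _, _, _, rfl, by simp [ws, this.1], this.2⟩

theorem ws_of_le_one {m : ℕ} (hm : 3 ≤ m) (w x) (h : wo m w x ≤ 1) :
    ws m w x = List.replicate w.length 0 := by
  induction w with
  | nil => rfl
  | cons q w ih =>
    simp only [wo] at h
    have h1 : wo m w x ≤ 1 ∧ t (wo m w x) q = 0 := by
      revert h; unfold o t
      rcases fin2 q with rfl | rfl <;> simp <;> grind
    simp [ws, ih h1.1, h1.2, List.replicate_succ]

/-- Sections leading to the letter 2. -/
theorem ws_of_two {m : ℕ} (hm : 4 ≤ m) (w x) (h : wo m w x = 2) :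
    ∃ a i, ws m w x = List.replicate a 1 ++ List.replicate i 0 ∧ (x ≤ 1 → 1 ≤ a) := by
  induction w with
  | nil => simp only [wo] at h; exact ⟨0, 0, rfl, by omega⟩
  | cons q w ih =>
    simp only [wo] at h
    rcases fin2 q with rfl | rfl
    · have h1 : wo m w x = 2 := by
        revert h; simp [o]; grind
      obtain ⟨a, i, h2, h3⟩ := ih h1
      exact ⟨a + 1, i, by simp [ws, h1, h2, t, List.replicate_succ], by omega⟩
    · have h1 : wo m w x = 1 := by
        revert h; simp [o]; omega
      exact ⟨1, w.length, by simp [ws, ws_of_le_one (by omega) w x h1.le, h1, t], by omega⟩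

theorem ws_of_two_three (w x) (hx : x ≤ 1) (h : wo 3 w x = 2) :
    ∃ a i, ws 3 w x = List.replicate a 1 ++ List.replicate i 0 := by
  induction w with
  | nil => simp only [wo] at h; omega
  | cons q w ih =>
    simp only [wo] at h
    rcases fin2 q with rfl | rfl
    · have h1 : wo 3 w x = 2 := by
        revert h; simp [o]; grind
      obtain ⟨a, i, h2⟩ := ih h1
      exact ⟨a + 1, i, by simp [ws, h1, h2, t, List.replicate_succ]⟩
    · have h1 : wo 3 w x = 1 ∨ wo 3 w x = 2 := by
        have := wo_lt (m := 3) (by omega) (show x < 3 by omega) w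
        revert h; simp [o]; omega
      rcases h1 with h1 | h1
      · exact ⟨1, w.length, by simp [ws, ws_of_le_one (by omega) w x h1.le, h1, t]⟩
      · obtain ⟨a, i, h2⟩ := ih h1
        exact ⟨a + 1, i, by simp [ws, h1, h2, t, List.replicate_succ]⟩

theorem wo_zeros_le (m k x) (hx : x ≤ 1) : wo m (List.replicate k 0) x ≤ 1 := by
  induction k with
  | zero => exact hx
  | succ k ih => simp only [List.replicate_succ, wo, o]; grind

theorem ws_zeros {m : ℕ} (hm : 3 ≤ m) (k x) (hx : x ≤ 1) :
    ws m (List.replicate k 0) x = List.replicate k 0 := by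
  simpa using ws_of_le_one hm _ x (wo_zeros_le m k x hx)

theorem exists_zeros (m k c : ℕ) (hc : c ≤ 1) : ∃ x ≤ 1, wo m (List.replicate k 0) x = c := by
  induction k generalizing c with
  | zero => exact ⟨c, hc, rfl⟩
  | succ k ih =>
    obtain ⟨x, hx, h⟩ := ih (1 - c) (by omega)
    refine ⟨x, hx, ?_⟩
    simp only [List.replicate_succ, wo, o, h]; grind

theorem wo_ones (m a y : ℕ) (hy : y < m) :
    wo m (List.replicate a 1) y = min (a + y) (m - 1) := by
  induction a with
  | zero => simp [wo]; omega
  | succ a ih => simp [List.replicate_succ, wo, o, ih]; omega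

theorem ws_ones_one {m : ℕ} (hm : 3 ≤ m) (a : ℕ) :
    ws m (List.replicate a 1) 1 = List.replicate a 1 := by
  induction a with
  | zero => rfl
  | succ a ih =>
    have : ¬ (min (a + 1) (m - 1) = 0) := by omega
    simp only [List.replicate_succ, ws, ih, wo_ones m a 1 (by omega), t]
    simp; omega

theorem ws_ones_zero {m : ℕ} (hm : 3 ≤ m) (a : ℕ) :
    ws m (List.replicate (a + 1) 1) 0 = List.replicate a 1 ++ [0] := by
  rw [List.replicate_succ', ws_append]
  simp [wo, ws, o, t]
  rw [min_eq_left (by omega), ws_ones_one hm]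

theorem ones_zeros_ne {m : ℕ} (hm : 3 ≤ m) (b : ℕ) : ∀ a i j : ℕ, b < a → a + i = b + j →
    ¬ E m (List.replicate a 1 ++ List.replicate i 0) (List.replicate b 1 ++ List.replicate j 0) := by
  induction b with
  | zero =>
    intro a i j hb hs h
    obtain ⟨x, hx, hx0⟩ := exists_zeros m j 0 (by omega)
    have h1 := (h.step (x := x) (by omega)).1
    have h2 := wo_zeros_le m i x hx
    rw [wo_append, wo_append, hx0, wo_ones _ _ _ (by omega), wo_ones _ _ _ (by omega)] at h1
    omega
  | succ b ih =>
    intro a i j hb hs h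
    obtain ⟨x, hx, hx0⟩ := exists_zeros m j 0 (by omega)
    have h1 := (h.step (x := x) (by omega)).2
    have h2 := wo_zeros_le m i x hx
    rw [ws_append, ws_append, hx0, ws_ones_zero hm, ws_zeros hm _ _ hx, ws_zeros hm _ _ hx,
      List.append_assoc] at h1
    change E m _ (List.replicate b 1 ++ List.replicate (j + 1) 0) at h1
    obtain h3 | h3 : wo m (List.replicate i 0) x = 0 ∨ wo m (List.replicate i 0) x = 1 := by omega
    · obtain ⟨a, rfl⟩ : ∃ a', a = a' + 1 := ⟨a - 1, by omega⟩
      rw [h3, ws_ones_zero hm, List.append_assoc] at h1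
      exact ih a (i + 1) (j + 1) (by omega) (by omega) h1
    · rw [h3, ws_ones_one hm] at h1
      exact ih a i (j + 1) (by omega) (by omega) h1

theorem ones_zeros_inj {m : ℕ} (hm : 3 ≤ m) {a b i j : ℕ} (hs : a + i = b + j)
    (h : E m (List.replicate a 1 ++ List.replicate i 0)
      (List.replicate b 1 ++ List.replicate j 0)) : a = b := by
  rcases lt_trichotomy a b with h1 | h1 | h1
  · exact (ones_zeros_ne hm a b j i h1 hs.symm h.symm).elim
  · exact h1
  · exact (ones_zeros_ne hm b a i j h1 hs h).elim

/-! ### Passing from `m + 1` to `m` letters, `m ≥ 4` -/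

theorem quot {m : ℕ} (hm : 4 ≤ m) (w x) (hx : x < m + 1) :
    wo m w (min x (m - 1)) = min (wo (m + 1) w x) (m - 1) ∧
      ws m w (min x (m - 1)) = ws (m + 1) w x := by
  induction w with
  | nil => exact ⟨rfl, rfl⟩
  | cons q w ih =>
    have := wo_lt (m := m + 1) (by omega) hx w
    simp only [wo, ws, ih.1, ih.2]
    constructor
    · rcases fin2 q with rfl | rfl <;> simp [o] <;> grind
    · congr 1
      rcases fin2 q with rfl | rfl <;> simp [t] <;> grind

theorem E.down {m : ℕ} (hm : 4 ≤ m) {u v} (h : E (m + 1) u v) : E m u v := by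
  refine ⟨E (m + 1), h, fun u v h x hx => ?_⟩
  have h1 := quot hm u x (by omega)
  have h2 := quot hm v x (by omega)
  have h3 := h.step (x := x) (by omega)
  rw [min_eq_left (by omega)] at h1 h2
  exact ⟨by rw [h1.1, h2.1, h3.1], by rw [h1.2, h2.2]; exact h3.2⟩

/-- One step from `E M (1 :: u) (1 :: v)`. -/
theorem one_step {M : ℕ} (hM : 4 ≤ M) {u v} (hl : u.length = v.length)
    (h : E M (1 :: u) (1 :: v)) {x} (hx : x < M) :
    min (wo M u x) (M - 2) = min (wo M v x) (M - 2) ∧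
      (E M (1 :: ws M u x) (1 :: ws M v x) ∨ ws M u x = ws M v x) := by
  have h1 := h.step hx
  simp only [wo, ws] at h1
  have h2 : min (wo M u x) (M - 2) = min (wo M v x) (M - 2) := by
    have := h1.1
    simp [o] at this; omega
  refine ⟨h2, ?_⟩
  by_cases h0 : wo M u x = 0
  · have h0' : wo M v x = 0 := by omega
    right
    rw [ws_of_le_one (by omega) u x (by omega), ws_of_le_one (by omega) v x (by omega), hl]
  · have h0' : wo M v x ≠ 0 := by omega
    left
    simpa [t, h0, h0'] using h1.2

/-- One step towards `E M (1 :: u) (1 :: v)`. -/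
theorem one_step_conv {M : ℕ} (hM : 4 ≤ M) {u v} (hl : u.length = v.length) {x}
    (h : min (wo M u x) (M - 2) = min (wo M v x) (M - 2)) :
    wo M (1 :: u) x = wo M (1 :: v) x ∧
      ((ws M (1 :: u) x = 1 :: ws M u x ∧ ws M (1 :: v) x = 1 :: ws M v x) ∨
        ws M (1 :: u) x = ws M (1 :: v) x) := by
  constructor
  · simp [wo, o]; omega
  · by_cases h0 : wo M u x = 0
    · have h0' : wo M v x = 0 := by omega
      right
      simp only [ws]
      rw [ws_of_le_one (by omega) u x (by omega), ws_of_le_one (by omega) v x (by omega), hl,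
        h0, h0']
    · have h0' : wo M v x ≠ 0 := by omega
      left
      simp [ws, t, h0, h0']

theorem one_iff_big {m : ℕ} (hm : 4 ≤ m) {u v : List (Fin 2)} (hl : u.length = v.length) :
    E (m + 1) (1 :: u) (1 :: v) ↔ E m u v := by
  constructor
  · intro h
    refine ⟨fun u v => u.length = v.length ∧ (E (m + 1) (1 :: u) (1 :: v) ∨ u = v),
      ⟨hl, Or.inl h⟩, ?_⟩
    rintro u v ⟨hl, h | rfl⟩ x hx
    · have h1 := quot hm u x (by omega)
      have h2 := quot hm v x (by omega)
      rw [min_eq_left (by omega)] at h1 h2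
      have h3 := one_step (by omega) hl h (x := x) (by omega)
      exact ⟨by rw [h1.1, h2.1]; exact h3.1, by simp [hl], by rw [h1.2, h2.2]; exact h3.2⟩
    · exact ⟨rfl, rfl, Or.inr rfl⟩
  · intro h
    refine ⟨fun a b => a = b ∨ ∃ u v, u.length = v.length ∧ a = 1 :: u ∧ b = 1 :: v ∧ E m u v,
      Or.inr ⟨u, v, hl, rfl, rfl, h⟩, ?_⟩
    rintro a b (rfl | ⟨u, v, hl, rfl, rfl, h⟩) x hx
    · exact ⟨rfl, Or.inl rfl⟩
    · have h1 := quot hm u x (by omega)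
      have h2 := quot hm v x (by omega)
      have h3 := h.step (x := min x (m - 1)) (by omega)
      rw [h1.1, h2.1, h1.2, h2.2] at h3
      have h4 := one_step_conv (M := m + 1) (by omega) hl h3.1
      refine ⟨h4.1, ?_⟩
      rcases h4.2 with h5 | h5
      · exact Or.inr ⟨_, _, by simp [hl], h5.1, h5.2, h3.2⟩
      · exact Or.inl h5

/-! ### Passing from 4 letters to 3 letters -/

theorem three_two (w) : wo 3 w 2 = 2 ∧ ws 3 w 2 = List.replicate w.length 1 := by
  induction w with
  | nil => exact ⟨rfl, rfl⟩
  | cons q w ih =>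
    simp only [wo, ws, ih.1, ih.2]
    rcases fin2 q with rfl | rfl <;> simp [o, t, List.replicate_succ]

theorem four_three (w) : wo 4 w 3 = 3 ∧ ws 4 w 3 = w := by
  induction w with
  | nil => exact ⟨rfl, rfl⟩
  | cons q w ih =>
    simp only [wo, ws, ih.1, ih.2]
    rcases fin2 q with rfl | rfl <;> simp [o, t]

theorem oneone {a b : List (Fin 2)} (hl : a.length = b.length) (c) :
    E 3 (a ++ 1 :: 1 :: c) (b ++ 1 :: 1 :: c) := by
  have key : E 3 (a ++ [1, 1]) (b ++ [1, 1]) := by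
    refine E.of_step fun x hx => ?_
    have h2 : wo 3 [1, 1] x = 2 := by
      interval_cases x <;> rfl
    rw [wo_append, wo_append, ws_append, ws_append, h2, (three_two a).1, (three_two b).1,
      (three_two a).2, (three_two b).2, hl]
    exact ⟨rfl, E.refl _ _⟩
  simpa using key.append_right (by omega) c

theorem compare (w x) (hx : x ≤ 1) :
    (wo 4 w x ≤ 2 ∧ wo 3 w x = wo 4 w x ∧ ws 3 w x = ws 4 w x ∧
        (wo 4 w x = 2 → ∃ c, ws 4 w x = 1 :: c)) ∨
      (wo 4 w x = 3 ∧ wo 3 w x = 2 ∧ ∃ a c, ws 4 w x = a ++ 1 :: 1 :: c ∧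
        ws 3 w x = List.replicate a.length 1 ++ 1 :: 1 :: c) := by
  induction w with
  | nil => left; exact ⟨by simp only [wo]; omega, rfl, rfl, by simp only [wo]; omega⟩
  | cons q w ih =>
    rcases ih with ⟨h1, h2, h3, h4⟩ | ⟨h1, h2, a, c, h3, h4⟩
    · obtain h5 | h5 : wo 4 w x ≤ 1 ∨ wo 4 w x = 2 := by omega
      · left
        simp only [wo, ws, h2, h3]
        rcases fin2 q with rfl | rfl
        · simp only [o, t]; grind
        · obtain h6 | h6 : wo 4 w x = 0 ∨ wo 4 w x = 1 := by omega
          · simp [o, t, h6]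
          · simp [o, t, h6]
      · obtain ⟨c, hc⟩ := h4 h5
        simp only [wo, ws, h2, h3, h5]
        rcases fin2 q with rfl | rfl
        · left; simp [o, t]
        · right
          exact ⟨by simp [o], by simp [o], [], c, by simp [t, hc], by simp [t, hc]⟩
    · right
      simp only [wo, ws, h1, h2, h3, h4]
      rcases fin2 q with rfl | rfl
      · exact ⟨by simp [o], by simp [o], 0 :: a, c, by simp [t], by simp [t, List.replicate_succ]⟩
      · exact ⟨by simp [o], by simp [o], 1 :: a, c, by simp [t], by simp [t, List.replicate_succ]⟩

theorem compare' (w x) (hx : x ≤ 1) :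
    wo 3 w x = min (wo 4 w x) 2 ∧ E 3 (ws 3 w x) (ws 4 w x) := by
  rcases compare w x hx with ⟨h1, h2, h3, -⟩ | ⟨h1, h2, a, c, h3, h4⟩
  · exact ⟨by omega, by rw [h3]; exact E.refl _ _⟩
  · exact ⟨by omega, by rw [h3, h4]; exact oneone (by simp) c⟩

theorem trailing {u s : List (Fin 2)} {k l : ℕ}
    (hl : (u ++ 1 :: List.replicate k 0).length = (s ++ List.replicate l 0).length)
    (h : E 3 (u ++ 1 :: List.replicate k 0) (s ++ List.replicate l 0)) : l ≤ k := by
  obtain ⟨x, hx, hx1⟩ := exists_zeros 3 k 1 le_rfl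
  have h1 := h.step (x := x) (by omega)
  have e : o 3 1 1 = 2 := rfl
  have e' : t 1 1 = 1 := rfl
  have hy := wo_zeros_le 3 l x hx
  simp only [wo_append, ws_append, wo, ws, hx1, e, e', (three_two u).1, (three_two u).2,
    ws_zeros (m := 3) le_rfl _ _ hx] at h1
  obtain ⟨a, i, hi⟩ := ws_of_two_three s _ hy h1.1.symm
  have hlen : s.length = a + i := by
    have := congrArg List.length hi
    simpa using this
  have h2 := h1.2
  rw [hi] at h2
  have h3 : E 3 (List.replicate (u.length + 1) 1 ++ List.replicate k 0)
      (List.replicate a 1 ++ List.replicate (i + l) 0) := by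
    rw [List.replicate_succ', List.append_assoc, List.replicate_add,
      ← List.append_assoc (List.replicate a 1)]
    exact h2
  simp at hl
  have := ones_zeros_inj le_rfl (by omega) h3
  omega

theorem decomp (w : List (Fin 2)) :
    w = List.replicate w.length 0 ∨ ∃ u k, w = u ++ 1 :: List.replicate k 0 := by
  induction w with
  | nil => left; rfl
  | cons q w ih =>
    rcases ih with h | ⟨u, k, h⟩
    · rcases fin2 q with rfl | rfl
      · left; simp only [List.length_cons, List.replicate_succ]; rw [← h]
      · right; exact ⟨[], w.length, by rw [← h]; rfl⟩
    · right; exact ⟨q :: u, k, by rw [h]; rfl⟩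

theorem zeros_two (k : ℕ) : wo 4 (List.replicate k 0) 2 = 2 ∧
    ws 4 (List.replicate k 0) 2 = List.replicate k 1 := by
  induction k with
  | zero => exact ⟨rfl, rfl⟩
  | succ k ih => simp [List.replicate_succ, wo, ws, ih.1, ih.2, o, t]

theorem ws_four_two (u : List (Fin 2)) (k : ℕ) :
    ws 4 (u ++ 1 :: List.replicate k 0) 2 = u ++ 1 :: List.replicate k 1 := by
  have e : o 4 2 1 = 3 := rfl
  have e' : t 2 1 = 1 := rfl
  simp only [ws_append, wo, ws, (zeros_two k).1, (zeros_two k).2, e, e', (four_three u).2]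

theorem at_two {u v : List (Fin 2)} (hl : u.length = v.length) (h : E 3 u v) :
    E 3 (ws 4 u 2) (ws 4 v 2) := by
  rcases decomp u with hu | ⟨u', k, rfl⟩
  · rcases decomp v with hv | ⟨v', l, rfl⟩
    · rw [hu, hv, hl]; exact E.refl _ _
    · rw [hu] at h
      have := trailing (s := []) (by simp at hl ⊢; omega) h.symm
      simp at hl; omega
  · rcases decomp v with hv | ⟨v', l, rfl⟩
    · rw [hv] at h
      have := trailing (s := []) (by simp at hl ⊢; omega) h
      simp at hl; omega
    · have h1 : l ≤ k := by
        have h' : E 3 (u' ++ 1 :: List.replicate k 0) ((v' ++ [1]) ++ List.replicate l 0) := by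
          simpa using h
        exact trailing (by simpa using hl) h'
      have h2 : k ≤ l := by
        have h' : E 3 (v' ++ 1 :: List.replicate l 0) ((u' ++ [1]) ++ List.replicate k 0) := by
          simpa using h.symm
        exact trailing (by simpa using hl.symm) h'
      obtain rfl : k = l := by omega
      rw [ws_four_two, ws_four_two]
      cases k with
      | zero => exact h
      | succ k =>
        rw [List.replicate_succ]
        exact oneone (by simpa using hl) _

theorem one_iff_four {u v : List (Fin 2)} (hl : u.length = v.length) :
    E 4 (1 :: u) (1 :: v) ↔ E 3 u v := by
  constructor
  · intro h
    refine ⟨fun u v => ∃ u' v', u'.length = v'.length ∧ u.length = v.length ∧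
      E 3 u u' ∧ E 3 v v' ∧ (E 4 (1 :: u') (1 :: v') ∨ u' = v'),
      ⟨u, v, hl, hl, E.refl _ _, E.refl _ _, Or.inl h⟩, ?_⟩
    rintro u v ⟨u', v', hl', hl, hu, hv, h⟩ x hx
    obtain h2 | h2 : x = 2 ∨ x ≤ 1 := by omega
    · subst h2
      rw [(three_two u).1, (three_two v).1, (three_two u).2, (three_two v).2, hl]
      exact ⟨rfl, _, _, rfl, rfl, E.refl _ _, E.refl _ _, Or.inr rfl⟩
    · have h3 := compare' u' x h2
      have h4 := compare' v' x h2
      have h5 := hu.step hx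
      have h6 := hv.step hx
      rcases h with h | rfl
      · have h7 := one_step le_rfl hl' h (x := x) (by omega)
        refine ⟨by rw [h5.1, h6.1, h3.1, h4.1]; exact h7.1, _, _, ?_, ?_,
          h5.2.trans h3.2, h6.2.trans h4.2, h7.2⟩ <;> simp [hl, hl']
      · exact ⟨by rw [h5.1, h6.1], _, _, rfl, by simp [hl], h5.2, h6.2, Or.inr rfl⟩
  · intro h
    refine ⟨fun a b => a = b ∨ ∃ u v, u.length = v.length ∧ a = 1 :: u ∧ b = 1 :: v ∧ E 3 u v,
      Or.inr ⟨u, v, hl, rfl, rfl, h⟩, ?_⟩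
    rintro a b (rfl | ⟨u, v, hl, rfl, rfl, h⟩) x hx
    · exact ⟨rfl, Or.inl rfl⟩
    · have key : min (wo 4 u x) 2 = min (wo 4 v x) 2 ∧ E 3 (ws 4 u x) (ws 4 v x) := by
        obtain h2 | h2 | h2 : x = 2 ∨ x = 3 ∨ x ≤ 1 := by omega
        · subst h2
          refine ⟨?_, at_two hl h⟩
          have hw : ∀ w, 2 ≤ wo 4 w 2 := by
            intro w
            induction w with
            | nil => exact le_rfl
            | cons q w ih =>
              rcases fin2 q with rfl | rfl <;> simp [wo, o] <;> grind
          have := hw u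
          have := hw v
          omega
        · subst h2
          rw [(four_three u).1, (four_three v).1, (four_three u).2, (four_three v).2]
          exact ⟨rfl, h⟩
        · have h3 := compare' u x h2
          have h4 := compare' v x h2
          have h5 := h.step (x := x) (by omega)
          exact ⟨by rw [← h3.1, ← h4.1, h5.1], h3.2.symm.trans (h5.2.trans h4.2)⟩
      have h4 := one_step_conv (M := 4) le_rfl hl key.1
      refine ⟨h4.1, ?_⟩
      rcases h4.2 with h5 | h5
      · exact Or.inr ⟨_, _, by simp [hl], h5.1, h5.2, key.2⟩
      · exact Or.inl h5

theorem one_iff {m : ℕ} (hm : 3 ≤ m) {u v : List (Fin 2)} (hl : u.length = v.length) :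
    E (m + 1) (1 :: u) (1 :: v) ↔ E m u v := by
  obtain rfl | h : m = 3 ∨ 4 ≤ m := by omega
  · exact one_iff_four hl
  · exact one_iff_big h hl

/-! ### Left cancellation of `q0` -/

theorem zero_iff {m : ℕ} (hm : 4 ≤ m) {u v : List (Fin 2)} (hl : u.length = v.length) :
    E m (0 :: u) (0 :: v) ↔ E m u v := by
  refine ⟨fun h => ?_, fun h => h.cons 0⟩
  refine ⟨fun u v => u.length = v.length ∧ (E m (0 :: u) (0 :: v) ∨ u = v),
      ⟨hl, Or.inl h⟩, ?_⟩
  rintro u v ⟨hl, h | rfl⟩ x hx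
  · have h1 := h.step hx
    simp only [wo, ws] at h1
    have h2 : wo m u x = wo m v x := by
      have := h1.1
      simp only [o] at this
      grind
    refine ⟨h2, by simp [hl], ?_⟩
    by_cases h3 : wo m v x = 2
    · right
      have h4 := h1.2
      obtain ⟨a, i, ha, -⟩ := ws_of_two hm u x (h2.trans h3)
      obtain ⟨b, j, hb, -⟩ := ws_of_two hm v x h3
      have la := congrArg List.length ha
      have lb := congrArg List.length hb
      simp at la lb
      rw [h2, h3, ha, hb] at h4
      have h5 : E m (List.replicate (a + 1) 1 ++ List.replicate i 0)
        (List.replicate (b + 1) 1 ++ List.replicate j 0) := h4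
      have := ones_zeros_inj (by omega) (by omega) h5
      obtain rfl : a = b := by omega
      obtain rfl : i = j := by omega
      rw [ha, hb]
    · left
      simpa [t, h2, h3] using h1.2
  · exact ⟨rfl, rfl, Or.inr rfl⟩

/-! ### Words starting with different states are different -/

theorem ne_one {u v : List (Fin 2)} (hl : u.length = v.length) (h : E 4 (0 :: u) (1 :: v))
    {x : ℕ} (hx : x ≤ 1) (h1 : wo 4 v x = 1) : False := by
  have h2 := h.step (x := x) (by omega)
  simp only [wo, ws, h1] at h2
  have h3 : wo 4 u x = 2 := by
    have := h2.1
    simp [o] at this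
    grind
  obtain ⟨a, i, ha, hpos⟩ := ws_of_two le_rfl u x h3
  have la := congrArg List.length ha
  simp at la
  have h4 := h2.2
  rw [h3, ha, ws_of_le_one (by omega) v x (by omega)] at h4
  have h5 : E 4 (List.replicate (a + 1) 1 ++ List.replicate i 0)
    (List.replicate 1 1 ++ List.replicate v.length 0) := h4
  have := ones_zeros_inj (by omega) (by omega) h5
  have := hpos hx
  omega

theorem ne_two {u v : List (Fin 2)} (h : E 4 (0 :: u) (1 :: v))
    {x : ℕ} (hx : x ≤ 1) (h1 : 2 ≤ wo 4 v x) : E 4 (0 :: ws 4 u x) (1 :: ws 4 v x) := by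
  have h2 := h.step (x := x) (by omega)
  simp only [wo, ws] at h2
  have h3 : wo 4 u x = 3 := by
    have := h2.1
    simp [o] at this
    grind
  have h4 : wo 4 v x ≠ 0 := by omega
  simpa [t, h3, h4] using h2.2

theorem two_le (w : List (Fin 2)) {x : ℕ} (hx : 2 ≤ x) : 2 ≤ wo 4 w x := by
  induction w with
  | nil => exact hx
  | cons q w ih =>
    rcases fin2 q with rfl | rfl <;> simp [wo, o] <;> grind

theorem ne_main (d : ℕ) : ∀ (l : ℕ) (u s : List (Fin 2)), s.length = d → u.length = d + l →
    ¬ E 4 (0 :: u) (1 :: (s ++ List.replicate l 0)) := by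
  induction d with
  | zero =>
    intro l u s hs hu h
    obtain rfl := List.length_eq_zero_iff.1 hs
    obtain ⟨x, hx, hx1⟩ := exists_zeros 4 l 1 le_rfl
    exact ne_one (by simpa using hu) h hx hx1
  | succ d ih =>
    intro l u s hs hu h
    obtain rfl | ⟨s, q, rfl⟩ := List.eq_nil_or_concat' s
    · simp at hs
    simp only [List.length_append, List.length_cons, List.length_nil] at hs
    rw [List.append_assoc] at h
    rcases fin2 q with rfl | rfl
    · exact ih (l + 1) u s (by omega) (by omega) h
    obtain ⟨x0, hx0, h0⟩ := exists_zeros 4 l 0 (by omega)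
    obtain ⟨x1, hx1, h1⟩ := exists_zeros 4 l 1 (by omega)
    have z0 := ws_zeros (m := 4) (by omega) l x0 hx0
    have z1 := ws_zeros (m := 4) (by omega) l x1 hx1
    obtain rfl | ⟨s, q, rfl⟩ := List.eq_nil_or_concat' s
    · refine ne_one (by simp at hs hu ⊢; omega) h hx0 ?_
      simp [wo, h0, o]
    simp only [List.length_append, List.length_cons, List.length_nil] at hs
    have e1 : wo 4 [1] 1 = 2 := rfl
    have e2 : ws 4 [1] 1 = [1] := rfl
    have e3 : ws 4 [q] 2 = [1] := by
      rcases fin2 q with rfl | rfl <;> rfl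
    have e4 : ws 4 [1] 0 = [0] := rfl
    have e5 : wo 4 [1] 0 = 1 := rfl
    have h2 := ne_two h hx1 (by
      rw [wo_append, wo_append 4 [1], h1, e1]; exact two_le _ le_rfl)
    simp only [ws_append, wo_append, h1, z1, e1, e2, e3] at h2
    have hs' : (ws 4 s (wo 4 [q] 2)).length = s.length := length_ws ..
    generalize ws 4 s (wo 4 [q] 2) = s' at h2 hs'
    have h3 := ne_two h2 hx0 (by
      rw [wo_append, wo_append 4 [1], h0, e5, wo_append, e1]; exact two_le _ le_rfl)
    simp only [ws_append, wo_append, h0, z0, e1, e2, e4, e5] at h3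
    exact ih (l + 1) _ (ws 4 s' 2 ++ [1]) (by simp; omega) (by simp; omega) h3

theorem ne_all {m : ℕ} (hm : 4 ≤ m) {u v : List (Fin 2)} (hl : u.length = v.length) :
    ¬ E m (0 :: u) (1 :: v) := by
  induction m, hm using Nat.le_induction with
  | base =>
    intro h
    exact ne_main v.length 0 u v rfl (by simpa using hl) (by simpa using h)
  | succ m hm ih => exact fun h => ih (h.down hm)

/-! ### Bridge to the transformations of infinite words -/

theorem bmOut_val {m : ℕ} (hm : 2 ≤ m) (x : Fin m) (q) : (bmOut m x q : ℕ) = o m x q := by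
  have : 1 % m = 1 := Nat.mod_eq_of_lt hm
  unfold bmOut o
  split_ifs <;> simp_all

theorem bmTr_eq {m : ℕ} (x : Fin m) (q) : bmTr m x q = t x q := rfl

theorem autTrans_zero (m q u) : autTrans (bmTr m) (bmOut m) q u 0 = bmOut m (u 0) q := rfl

theorem stateSeq_succ {m : ℕ} (q) (u : ℕ → Fin m) (n) :
    stateSeq (bmTr m) q u (n + 1) =
      stateSeq (bmTr m) (bmTr m (u 0) q) (fun k => u (k + 1)) n := by
  induction n with
  | zero => rfl
  | succ n ih => rw [stateSeq, ih]; rfl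

theorem autTrans_succ {m : ℕ} (q) (u : ℕ → Fin m) :
    (fun n => autTrans (bmTr m) (bmOut m) q u (n + 1)) =
      autTrans (bmTr m) (bmOut m) (bmTr m (u 0) q) (fun k => u (k + 1)) := by
  funext n
  simp only [autTrans, stateSeq_succ]

theorem wordTrans_cons {m : ℕ} (q w) : wordTrans (bmTr m) (bmOut m) (q :: w) =
    autTrans (bmTr m) (bmOut m) q ∘ wordTrans (bmTr m) (bmOut m) w := rfl

theorem wordTrans_zero {m : ℕ} (hm : 2 ≤ m) (w) (u : ℕ → Fin m) :
    (wordTrans (bmTr m) (bmOut m) w u 0).val = wo m w (u 0) := by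
  induction w with
  | nil => rfl
  | cons q w ih =>
    rw [wordTrans_cons, Function.comp, autTrans_zero, bmOut_val hm, ih]; rfl

theorem wordTrans_succ {m : ℕ} (hm : 2 ≤ m) (w) (u : ℕ → Fin m) :
    (fun n => wordTrans (bmTr m) (bmOut m) w u (n + 1)) =
      wordTrans (bmTr m) (bmOut m) (ws m w (u 0)) (fun k => u (k + 1)) := by
  induction w with
  | nil => rfl
  | cons q w ih =>
    rw [wordTrans_cons, Function.comp, autTrans_succ, ih, bmTr_eq, wordTrans_zero hm]
    rfl

theorem wordTrans_iff {m : ℕ} (hm : 2 ≤ m) (w v) :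
    wordTrans (bmTr m) (bmOut m) w = wordTrans (bmTr m) (bmOut m) v ↔ E m w v := by
  constructor
  · intro h
    refine ⟨fun w v => wordTrans (bmTr m) (bmOut m) w = wordTrans (bmTr m) (bmOut m) v, h, ?_⟩
    intro w v h x hx
    constructor
    · have h1 := wordTrans_zero hm w (fun _ => ⟨x, hx⟩)
      have h2 := wordTrans_zero hm v (fun _ => ⟨x, hx⟩)
      rw [h] at h1
      exact h1.symm.trans h2
    · funext u
      have h1 := wordTrans_succ hm w (fun n => Nat.casesOn n ⟨x, hx⟩ u)
      have h2 := wordTrans_succ hm v (fun n => Nat.casesOn n ⟨x, hx⟩ u)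
      rw [h] at h1
      exact h1.symm.trans h2
  · intro h
    funext u n
    induction n generalizing w v u with
    | zero =>
      apply Fin.ext
      rw [wordTrans_zero hm, wordTrans_zero hm]
      exact (h.step (u 0).2).1
    | succ n ih =>
      rw [congrFun (wordTrans_succ hm w u) n, congrFun (wordTrans_succ hm v u) n]
      exact ih _ _ (h.step (u 0).2).2 _

/-! ### Counting -/

theorem ncard_image_eq {T α β : Type*} (s : Set T) (f : T → α) (g : T → β)
    (h : ∀ a ∈ s, ∀ b ∈ s, f a = f b ↔ g a = g b) : (f '' s).ncard = (g '' s).ncard := by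
  choose c hc using fun (y : α) (hy : y ∈ f '' s) => hy
  refine Set.ncard_congr (fun y hy => g (c y hy)) ?_ ?_ ?_
  · intro y hy
    exact ⟨_, (hc y hy).1, rfl⟩
  · intro y z hy hz e
    rw [← (hc y hy).2, ← (hc z hz).2]
    exact (h _ (hc y hy).1 _ (hc z hz).1).2 e
  · rintro _ ⟨a, ha, rfl⟩
    have hy : f a ∈ f '' s := ⟨a, ha, rfl⟩
    exact ⟨f a, hy, (h _ (hc _ hy).1 _ ha).1 (hc _ hy).2⟩

theorem growth_eq (m n : ℕ) : growth (bmTr m) (bmOut m) n =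
    (wordTrans (bmTr m) (bmOut m) '' {w | w.length = n}).ncard := rfl

theorem finite_words (n : ℕ) : {w : List (Fin 2) | w.length = n}.Finite :=
  List.finite_length_eq _ n

theorem growth_succ {m : ℕ} (hm : 3 ≤ m) (n : ℕ) :
    growth (bmTr (m + 1)) (bmOut (m + 1)) (n + 1) =
      growth (bmTr (m + 1)) (bmOut (m + 1)) n + growth (bmTr m) (bmOut m) n := by
  let F := wordTrans (bmTr (m + 1)) (bmOut (m + 1))
  let L := {w : List (Fin 2) | w.length = n}
  have hsplit : F '' {w | w.length = n + 1} =
      (fun w => F (0 :: w)) '' L ∪ (fun w => F (1 :: w)) '' L := by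
    ext g
    constructor
    · rintro ⟨w, hw, rfl⟩
      cases w with
      | nil => simp at hw
      | cons q w =>
        have hw' : w ∈ L := Nat.succ.inj hw
        rcases fin2 q with rfl | rfl
        · exact Or.inl ⟨w, hw', rfl⟩
        · exact Or.inr ⟨w, hw', rfl⟩
    · rintro (⟨w, hw, rfl⟩ | ⟨w, hw, rfl⟩)
      · exact ⟨0 :: w, congrArg (· + 1) hw, rfl⟩
      · exact ⟨1 :: w, congrArg (· + 1) hw, rfl⟩
  have hdisj : Disjoint ((fun w => F (0 :: w)) '' L) ((fun w => F (1 :: w)) '' L) := by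
    rw [Set.disjoint_left]
    rintro _ ⟨u, hu, rfl⟩ ⟨v, hv, e⟩
    exact ne_all (m := m + 1) (by omega) (hu.trans hv.symm)
      ((wordTrans_iff (by omega) _ _).1 e.symm)
  have hfin : L.Finite := finite_words n
  rw [growth_eq, growth_eq, growth_eq]
  change (F '' _).ncard = _
  rw [hsplit, Set.ncard_union_eq hdisj (hfin.image _) (hfin.image _)]
  congr 1
  · refine ncard_image_eq L _ _ fun u hu v hv => ?_
    change wordTrans _ _ _ = wordTrans _ _ _ ↔ _
    rw [wordTrans_iff (by omega), wordTrans_iff (by omega),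
      zero_iff (by omega) (hu.trans hv.symm)]
  · refine ncard_image_eq L _ _ fun u hu v hv => ?_
    change wordTrans _ _ _ = wordTrans _ _ _ ↔ _
    rw [wordTrans_iff (by omega), wordTrans_iff (by omega),
      one_iff hm (hu.trans hv.symm)]

end BmAux

/-- For every `m ≥ 4` and `n ≥ 2`, the first finite difference of the growth function of
`B_m` coincides with the growth function of `B_{m−1}` shifted by one:
`γ_{B_m}(n) − γ_{B_m}(n−1) = γ_{B_{m−1}}(n−1)` (stated additively in `ℕ`). -/
theorem fdiff_growth_bm_pred (m : ℕ) (hm : 4 ≤ m) (n : ℕ) (hn : 2 ≤ n) :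
    growth (bmTr m) (bmOut m) n =
      growth (bmTr m) (bmOut m) (n - 1) + growth (bmTr (m - 1)) (bmOut (m - 1)) (n - 1) := by
  obtain ⟨k, rfl⟩ : ∃ k, m = k + 1 := ⟨m - 1, by omega⟩
  obtain ⟨l, rfl⟩ : ∃ l, n = l + 1 := ⟨n - 1, by omega⟩
  exact BmAux.growth_succ (by omega) l
end

section
/- Let γ be the growth function of the Mealy automaton A₆, and let Φ be the Fibonacci sequence with Φ₀ = Φ₁ = 1 and Φ_n = Φ_{n−1} + Φ_{n−2}. Then for every integer k ≥ 1, γ(2k+1) − γ(2k) = Φ_{k+4} − 2; for every integer k ≥ 0, γ(2k+2) − γ(2k+1) = 2·Φ_{k+3} − 2; and for every integer k ≥ 1 the second finite difference satisfies γ^(2)(2k+1) = γ^(2)(2k+2) = Φ_{k+1}. In particular the second finite difference of γ consists of doubled values: γ^(2)(n) = γ^(2)(n−1) for every even n ≥ 4. -/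
/-- Output function of the automaton `A₆`: at `q0` the output negates each letter; at `q1`
it is the identity; at `q2` it sends both letters to `x0`. -/
def a6Out : Fin 2 → Fin 3 → Fin 2 := fun x q =>
  if q = 0 then (if x = 0 then 1 else 0)
  else if q = 1 then x else 0

/-- Transition function of the automaton `A₆`: both transitions from `q0` stay at `q0`;
from `q1` and `q2` the transition goes to `q1` on reading `x0` and to `q2` on reading
`x1`. -/
def a6Tr : Fin 2 → Fin 3 → Fin 3 := fun x q =>
  if q = 0 then 0 else (if x = 0 then 1 else 2)

/-- The Fibonacci sequence `Φ` with `Φ₀ = Φ₁ = 1` and `Φ_n = Φ_{n−1} + Φ_{n−2}`. -/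
def Phi : ℕ → ℕ
  | 0 => 1
  | 1 => 1
  | n + 2 => Phi (n + 1) + Phi n

namespace A6

abbrev W := ℕ → Fin 2

def c : W → W := autTrans a6Tr a6Out 0
def p : W → W := autTrans a6Tr a6Out 1
def r : W → W := autTrans a6Tr a6Out 2

lemma c_apply (u : W) (n : ℕ) : c u n = if u n = 0 then 1 else 0 := by
  have h : ∀ n, stateSeq a6Tr 0 u n = 0 := by
    intro n
    induction n with
    | zero => rfl
    | succ k ih => simp [stateSeq, ih, a6Tr]
  simp [c, autTrans, h, a6Out]

lemma state_ne (q : Fin 3) (hq : q ≠ 0) (u : W) (n : ℕ) : stateSeq a6Tr q u n ≠ 0 := by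
  induction n with
  | zero => exact hq
  | succ k ih =>
    simp only [stateSeq, a6Tr, ih, if_false]
    split <;> decide

lemma aut_succ (q : Fin 3) (hq : q ≠ 0) (u : W) (n : ℕ) :
    autTrans a6Tr a6Out q u (n + 1) = if u n = 0 then u (n + 1) else 0 := by
  have h := state_ne q hq u n
  simp only [autTrans, stateSeq, a6Tr, h, if_false]
  by_cases h0 : u n = 0 <;> simp [h0, a6Out]

lemma p_succ (u : W) (n : ℕ) : p u (n + 1) = if u n = 0 then u (n + 1) else 0 :=
  aut_succ 1 (by decide) u n
lemma r_succ (u : W) (n : ℕ) : r u (n + 1) = if u n = 0 then u (n + 1) else 0 :=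
  aut_succ 2 (by decide) u n
lemma p_zero (u : W) : p u 0 = u 0 := by simp [p, autTrans, stateSeq, a6Out]
lemma r_zero (u : W) : r u 0 = 0 := by simp [r, autTrans, stateSeq, a6Out]

lemma fin2 (x : Fin 2) : x = 0 ∨ x = 1 := by omega

lemma c_c (u : W) : c (c u) = u := by
  funext n
  rcases fin2 (u n) with h | h <;> simp [c_apply, h]

lemma c_comp_c : c ∘ c = id := funext c_c

/-- no two adjacent ones -/
def Iso (v : W) : Prop := ∀ n, v n = 0 ∨ v (n + 1) = 0

lemma iso_p (u : W) : Iso (p u) := by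
  intro n
  rw [p_succ]
  by_cases h : u n = 0
  · left
    cases n with
    | zero => rw [p_zero, h]
    | succ m => rw [p_succ, h]; simp
  · right; simp [h]

lemma iso_r (u : W) : Iso (r u) := by
  intro n
  rw [r_succ]
  by_cases h : u n = 0
  · left
    cases n with
    | zero => rw [r_zero]
    | succ m => rw [r_succ, h]; simp
  · right; simp [h]

lemma p_iso {v : W} (h : Iso v) : p v = v := by
  funext n
  cases n with
  | zero => exact p_zero v
  | succ m =>
    rw [p_succ]
    split
    · rfl
    · rename_i h1
      exact ((h m).resolve_left h1).symm

lemma r_p (u : W) : r (p u) = r u := by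
  funext n
  cases n with
  | zero => simp [r_zero]
  | succ m =>
    rw [r_succ, r_succ, p_succ]
    cases m with
    | zero => rw [p_zero]; split <;> rfl
    | succ k =>
      rw [p_succ]
      rcases fin2 (u (k+1)) with h | h <;> simp [h]

lemma r_r (u : W) : r (r u) = r u := by
  funext n
  cases n with
  | zero => simp [r_zero]
  | succ m =>
    rw [r_succ, r_succ]
    rcases iso_r u m with h | h
    · simp [h]
    · rw [r_succ] at h
      simp [h]

/-- `X f = p c f` -/
def X (f : W → W) : W → W := p ∘ c ∘ f
/-- `Y f = r c f` -/
def Y (f : W → W) : W → W := r ∘ c ∘ f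

def C : ℕ → Set (W → W)
  | 0 => {p, r}
  | k + 1 => X '' C k ∪ Y '' C k

lemma C_iso {k : ℕ} {f : W → W} (hf : f ∈ C k) (u : W) : Iso (f u) := by
  cases k with
  | zero => rcases hf with rfl | rfl
            · exact iso_p u
            · exact iso_r u
  | succ k =>
    rcases hf with ⟨g, _, rfl⟩ | ⟨g, _, rfl⟩
    · exact iso_p _
    · exact iso_r _

lemma X_zero (f : W → W) (u : W) : X f u 0 = if f u 0 = 0 then 1 else 0 := by
  simp [X, p_zero, c_apply]
lemma Y_zero (f : W → W) (u : W) : Y f u 0 = 0 := by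
  simp [Y, r_zero]
lemma X_succ {k : ℕ} {f : W → W} (hf : f ∈ C k) (u : W) (n : ℕ) : X f u (n + 1) = f u n := by
  have h := C_iso hf u n
  simp only [X, Function.comp_apply, p_succ, c_apply]
  rcases fin2 (f u n) with h1 | h1 <;> simp [h1] at h ⊢ <;> simp [h]
lemma Y_succ {k : ℕ} {f : W → W} (hf : f ∈ C k) (u : W) (n : ℕ) : Y f u (n + 1) = f u n := by
  have h := C_iso hf u n
  simp only [Y, Function.comp_apply, r_succ, c_apply]
  rcases fin2 (f u n) with h1 | h1 <;> simp [h1] at h ⊢ <;> simp [h]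

lemma C_tail {k : ℕ} {f : W → W} (hf : f ∈ C k) (u : W) (n : ℕ) :
    f u (n + 1 + k) = if u n = 0 then u (n + 1) else 0 := by
  induction k generalizing f with
  | zero => rcases hf with rfl | rfl
            · exact p_succ u n
            · exact r_succ u n
  | succ k ih =>
    rcases hf with ⟨g, hg, rfl⟩ | ⟨g, hg, rfl⟩
    · rw [← add_assoc, X_succ hg, ih hg]
    · rw [← add_assoc, Y_succ hg, ih hg]

lemma p_C {k : ℕ} {f : W → W} (hf : f ∈ C k) : p ∘ f = f :=
  funext fun u => p_iso (C_iso hf u)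

lemma r_C {k : ℕ} {f : W → W} (hf : f ∈ C k) : r ∘ f ∈ C k := by
  cases k with
  | zero =>
    right
    rcases hf with rfl | rfl
    · exact funext r_p
    · exact funext r_r
  | succ k =>
    right
    rcases hf with ⟨g, hg, rfl⟩ | ⟨g, hg, rfl⟩
    · exact ⟨g, hg, (funext fun u => (r_p _).symm)⟩
    · exact ⟨g, hg, (funext fun u => (r_r _).symm)⟩

lemma C_finite (k : ℕ) : (C k).Finite := by
  induction k with
  | zero => exact (Set.toFinite {p, r} : ({p, r} : Set (W → W)).Finite)
  | succ k ih => exact (ih.image X).union (ih.image Y)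

lemma X_inj (k : ℕ) : Set.InjOn X (C k) := by
  intro f hf g hg h
  funext u n
  rw [← X_succ hf, ← X_succ hg, h]
lemma Y_inj (k : ℕ) : Set.InjOn Y (C k) := by
  intro f hf g hg h
  funext u n
  rw [← Y_succ hf, ← Y_succ hg, h]

def O (k : ℕ) : Set (W → W) := {f | f ∈ C k ∧ ∀ u, f u 0 = 1}
def Z (k : ℕ) : Set (W → W) := {f | f ∈ C k ∧ ∀ u, f u 0 = 0}

lemma inter_eq (k : ℕ) : X '' C k ∩ Y '' C k = Y '' O k := by
  ext h
  constructor
  · rintro ⟨⟨f, hf, rfl⟩, ⟨g, hg, hh⟩⟩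
    have hfg : g = f := by
      funext u n
      rw [← X_succ hf, ← Y_succ hg, hh]
    subst hfg
    refine ⟨g, ⟨hg, fun u => ?_⟩, hh⟩
    have := congrFun (congrFun hh u) 0
    rw [X_zero, Y_zero] at this
    rcases fin2 (g u 0) with h1 | h1
    · simp [h1] at this
    · exact h1
  · rintro ⟨f, ⟨hf, h1⟩, rfl⟩
    refine ⟨⟨f, hf, ?_⟩, ⟨f, hf, rfl⟩⟩
    funext u n
    cases n with
    | zero => rw [X_zero, Y_zero, h1 u]; rfl
    | succ n => rw [X_succ hf, Y_succ hf]

lemma O_succ (k : ℕ) : O (k + 1) = X '' Z k := by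
  ext h
  constructor
  · rintro ⟨⟨f, hf, rfl⟩ | ⟨f, hf, rfl⟩, h1⟩
    · refine ⟨f, ⟨hf, fun u => ?_⟩, rfl⟩
      have := h1 u
      rw [X_zero] at this
      by_contra h2
      simp [h2] at this
    · have := h1 (fun _ => 0)
      rw [Y_zero] at this
      simp at this
  · rintro ⟨f, ⟨hf, h1⟩, rfl⟩
    refine ⟨Or.inl ⟨f, hf, rfl⟩, fun u => ?_⟩
    rw [X_zero, h1 u]; rfl

lemma Z_succ (k : ℕ) : Z (k + 1) = Y '' C k := by
  ext h
  constructor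
  · rintro ⟨⟨f, hf, rfl⟩ | ⟨f, hf, rfl⟩, h1⟩
    · refine ⟨f, hf, ?_⟩
      funext u n
      cases n with
      | zero => rw [h1 u, Y_zero]
      | succ n => rw [X_succ hf, Y_succ hf]
    · exact ⟨f, hf, rfl⟩
  · rintro ⟨f, hf, rfl⟩
    exact ⟨Or.inr ⟨f, hf, rfl⟩, fun u => Y_zero f u⟩

lemma p_ne_r : p ≠ r := by
  intro h
  have := congrFun (congrFun h (fun _ => 1)) 0
  rw [p_zero, r_zero] at this
  simp at this

lemma Phi_succ (n : ℕ) : Phi (n + 2) = Phi (n + 1) + Phi n := rfl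

lemma counts (k : ℕ) : (C k).ncard + 1 = Phi (k + 3) ∧ (Z k).ncard + 1 = Phi (k + 2) ∧
    (O k).ncard + 1 = Phi (k + 1) := by
  induction k with
  | zero =>
    have hZ : Z 0 = {r} := by
      ext f
      constructor
      · rintro ⟨rfl | rfl, h⟩
        · have := h (fun _ => 1)
          rw [p_zero] at this
          simp at this
        · rfl
      · rintro rfl
        exact ⟨Or.inr rfl, r_zero⟩
    have hO : O 0 = ∅ := by
      ext f
      constructor
      · rintro ⟨rfl | rfl, h⟩
        · have := h (fun _ => 0)
          rw [p_zero] at this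
          simp at this
        · have := h (fun _ => 0)
          rw [r_zero] at this
          simp at this
      · rintro ⟨⟩
    rw [hZ, hO]
    simp [C, Set.ncard_pair p_ne_r, Phi]
  | succ k ih =>
    obtain ⟨h1, h2, h3⟩ := ih
    have hO : O k ⊆ C k := fun f hf => hf.1
    have hZ : Z k ⊆ C k := fun f hf => hf.1
    have e := Set.ncard_union_add_ncard_inter (X '' C k) (Y '' C k)
      ((C_finite k).image X) ((C_finite k).image Y)
    rw [inter_eq, Set.InjOn.ncard_image (X_inj k), Set.InjOn.ncard_image (Y_inj k),
      Set.InjOn.ncard_image ((Y_inj k).mono hO)] at e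
    have e' : (C (k+1)).ncard + (O k).ncard = (C k).ncard + (C k).ncard := e
    rw [Z_succ, O_succ, Set.InjOn.ncard_image (Y_inj k),
      Set.InjOn.ncard_image ((X_inj k).mono hZ)]
    have := Phi_succ (k + 1)
    have := Phi_succ (k + 2)
    refine ⟨?_, h1, h2⟩
    rw [show k + 1 + 3 = k + 2 + 2 by ring]
    simp only [show k + 2 + 1 = k + 3 by ring, show k + 1 + 2 = k + 3 by ring,
      show k + 1 + 1 = k + 2 by ring] at *
    omega

/-! ### Normal forms -/

def cp (b : Bool) : W → W := if b then c else id

lemma cp_cp (b : Bool) (u : W) : cp b (cp b u) = u := by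
  cases b
  · rfl
  · exact c_c u

lemma cp_inj (b : Bool) : Function.Injective (cp b) := fun u v h => by
  rw [← cp_cp b u, h, cp_cp]

/-- the element `c^e f c^d` -/
def nf (e d : Bool) (f : W → W) : W → W := cp e ∘ f ∘ cp d

lemma nf_inj (e d : Bool) : Function.Injective (nf e d) := by
  intro f g h
  funext u
  have := congrFun h (cp d u)
  simp only [nf, Function.comp_apply, cp_cp] at this
  exact cp_inj e this

def E (e d : Bool) (k : ℕ) : Set (W → W) := nf e d '' C k

lemma E_ncard (e d : Bool) (k : ℕ) : (E e d k).ncard = (C k).ncard :=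
  Set.ncard_image_of_injective _ (nf_inj e d)

lemma E_finite (e d : Bool) (k : ℕ) : (E e d k).Finite := (C_finite k).image _

def step (N : ℕ) : W := fun m => if N ≤ m then 1 else 0

lemma tail_const {k : ℕ} {f : W → W} (hf : f ∈ C k) (d : Bool) (n : ℕ) :
    f (cp d fun _ => 0) (n + 1 + k) = 0 := by
  rw [C_tail hf]
  cases d <;> simp [cp, c_apply]

lemma E_e {e d e' d' : Bool} {k k' : ℕ} {g : W → W} (h : g ∈ E e d k) (h' : g ∈ E e' d' k') :
    e = e' := by
  obtain ⟨f, hf, rfl⟩ := h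
  obtain ⟨f', hf', he⟩ := h'
  have := congrFun (congrFun he fun _ => 0) (k' + 1 + k)
  have h1 := tail_const hf d k'
  have h2 := tail_const hf' d' k
  rw [show k + 1 + k' = k' + 1 + k by ring] at h2
  simp only [nf, Function.comp_apply] at this
  generalize f (cp d fun _ => 0) = a at this h1
  generalize f' (cp d' fun _ => 0) = b at this h2
  cases e <;> cases e' <;> simp [cp, c_apply, h1, h2] at this ⊢

lemma tail_step {k : ℕ} {f : W → W} (hf : f ∈ C k) (N m : ℕ) (hm : k < m) :
    f (step N) m = if m = N + k ∧ 0 < N then 1 else 0 := by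
  obtain ⟨n, rfl⟩ : ∃ n, m = n + 1 + k := ⟨m - 1 - k, by omega⟩
  rw [C_tail hf]
  simp only [step]
  by_cases h1 : N ≤ n
  · have : ¬ (n + 1 + k = N + k ∧ 0 < N) := by omega
    rw [if_neg this]
    simp [h1]
  · by_cases h2 : N ≤ n + 1
    · have : (n + 1 + k = N + k ∧ 0 < N) := by omega
      rw [if_pos this]
      simp [h1, h2]
    · have : ¬ (n + 1 + k = N + k ∧ 0 < N) := by omega
      rw [if_neg this]
      simp [h1, h2]

lemma tail_cstep {k : ℕ} {f : W → W} (hf : f ∈ C k) (N m : ℕ) (hm : k < m) :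
    f (c (step N)) m = 0 := by
  obtain ⟨n, rfl⟩ : ∃ n, m = n + 1 + k := ⟨m - 1 - k, by omega⟩
  rw [C_tail hf]
  simp only [c_apply, step]
  by_cases h1 : N ≤ n
  · have : N ≤ n + 1 := by omega
    simp [h1, this]
  · simp [h1]

lemma C_disj {k k' : ℕ} {f : W → W} (h : f ∈ C k) (h' : f ∈ C k') : k = k' := by
  have h1 := tail_step h (k' + 1) (k' + 1 + k) (by omega)
  have h2 := tail_step h' (k' + 1) (k' + 1 + k) (by omega)
  by_contra hne
  have : ¬ (k' + 1 + k = k' + 1 + k' ∧ 0 < k' + 1) := by omega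
  rw [h1, if_neg this] at h2
  simp at h2

lemma C_comp_c {k k' : ℕ} {f f' : W → W} (h : f ∈ C k) (h' : f' ∈ C k') (he : f = f' ∘ c) :
    False := by
  have h1 := tail_step h (k' + 1) (k' + 1 + k) (by omega)
  have h2 := tail_cstep h' (k' + 1) (k' + 1 + k) (by omega)
  rw [he] at h1
  simp [h2] at h1

lemma E_disj {e d e' d' : Bool} {k k' : ℕ} {g : W → W} (h : g ∈ E e d k) (h' : g ∈ E e' d' k') :
    e = e' ∧ d = d' ∧ k = k' := by
  have hee := E_e h h'
  subst hee
  obtain ⟨f, hf, rfl⟩ := h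
  obtain ⟨f', hf', he⟩ := h'
  have h0 : f' ∘ cp d' = f ∘ cp d := by
    funext u
    exact cp_inj e (congrFun he u)
  refine ⟨rfl, ?_⟩
  cases d <;> cases d'
  · exact ⟨rfl, C_disj hf (by simpa [cp] using (show f = f' from h0.symm) ▸ hf')⟩
  · exact (C_comp_c hf hf' h0.symm).elim
  · exact (C_comp_c hf' hf h0).elim
  · refine ⟨rfl, C_disj hf ?_⟩
    have : f = f' := by
      funext u
      have := congrFun h0 (c u)
      simpa [cp, c_c] using this.symm
    exact this ▸ hf'

lemma E_not_surj {e d : Bool} {k : ℕ} {g : W → W} (h : g ∈ E e d k) :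
    ¬ Function.Surjective g := by
  obtain ⟨f, hf, rfl⟩ := h
  intro hs
  obtain ⟨u, hu⟩ := hs (cp e fun _ => 1)
  have := cp_inj e hu
  have h2 := C_iso hf (cp d u) 0
  simp only [Function.comp_apply] at this
  rw [this] at h2
  simp at h2

lemma c_iter_surj (n : ℕ) : Function.Surjective (c^[n]) :=
  Function.Surjective.iterate (fun u => ⟨c u, c_c u⟩) n

lemma c_iter (n : ℕ) : ∃ b : Bool, c^[n] = cp b ∧ b.toNat ≤ n := by
  induction n with
  | zero => exact ⟨false, rfl, by simp⟩
  | succ n ih =>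
    obtain ⟨b, hb, hn⟩ := ih
    rw [Function.iterate_succ', hb]
    cases b
    · exact ⟨true, rfl, by simp⟩
    · exact ⟨false, c_comp_c, by simp⟩

def U (n : ℕ) : Set (W → W) :=
  {g | ∃ (e d : Bool) (k : ℕ), 2 * k + 1 + e.toNat + d.toNat ≤ n ∧ g ∈ E e d k}

def L (n : ℕ) : Set (W → W) :=
  {g | ∃ (e d : Bool) (k : ℕ), 2 * k + 1 + e.toNat + d.toNat = n ∧ g ∈ E e d k}

def S (n : ℕ) : Set (W → W) :=
  {g | ∃ w : List (Fin 3), w.length = n ∧ wordTrans a6Tr a6Out w = g}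

lemma wt_nil : wordTrans a6Tr a6Out [] = id := rfl
lemma wt_cons (q : Fin 3) (w : List (Fin 3)) :
    wordTrans a6Tr a6Out (q :: w) = autTrans a6Tr a6Out q ∘ wordTrans a6Tr a6Out w := rfl
lemma wt_append (w w' : List (Fin 3)) :
    wordTrans a6Tr a6Out (w ++ w') = wordTrans a6Tr a6Out w ∘ wordTrans a6Tr a6Out w' := by
  induction w with
  | nil => rfl
  | cons q w ih => rw [List.cons_append, wt_cons, ih, wt_cons]; rfl

lemma wt_mem (w : List (Fin 3)) :
    wordTrans a6Tr a6Out w = c^[w.length] ∨ wordTrans a6Tr a6Out w ∈ U w.length := by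
  induction w with
  | nil => exact Or.inl rfl
  | cons q w ih =>
    rw [wt_cons, List.length_cons]
    have hq : autTrans a6Tr a6Out q = c ∨ autTrans a6Tr a6Out q = p ∨
        autTrans a6Tr a6Out q = r := by
      fin_cases q
      · exact Or.inl rfl
      · exact Or.inr (Or.inl rfl)
      · exact Or.inr (Or.inr rfl)
    rcases ih with h | ⟨e, d, k, hn, f, hf, hfe⟩
    · obtain ⟨b, hb, hn⟩ := c_iter w.length
      rw [h]
      rcases hq with hq | hq | hq <;> rw [hq]
      · left; rw [Function.iterate_succ']
      · right
        rw [hb]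
        exact ⟨false, b, 0, by simp; omega, p, Or.inl rfl, rfl⟩
      · right
        rw [hb]
        exact ⟨false, b, 0, by simp; omega, r, Or.inr rfl, rfl⟩
    · right
      rw [← hfe]
      rcases hq with hq | hq | hq <;> rw [hq]
      · cases e
        · exact ⟨true, d, k, by simp at hn ⊢; omega, f, hf, rfl⟩
        · refine ⟨false, d, k, by simp at hn ⊢; omega, f, hf, ?_⟩
          funext u
          exact (c_c _).symm
      · cases e
        · refine ⟨false, d, k, by simp at hn ⊢; omega, p ∘ f, ?_, rfl⟩
          rw [p_C hf]; exact hf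
        · exact ⟨false, d, k + 1, by simp at hn ⊢; omega, X f, Or.inl ⟨f, hf, rfl⟩, rfl⟩
      · cases e
        · exact ⟨false, d, k, by simp at hn ⊢; omega, r ∘ f, r_C hf, rfl⟩
        · exact ⟨false, d, k + 1, by simp at hn ⊢; omega, Y f, Or.inr ⟨f, hf, rfl⟩, rfl⟩

lemma S_cons {n : ℕ} {g : W → W} (q : Fin 3) (h : g ∈ S n) :
    autTrans a6Tr a6Out q ∘ g ∈ S (n + 1) := by
  obtain ⟨w, hw, rfl⟩ := h
  exact ⟨q :: w, by simp [hw], rfl⟩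

lemma S_snoc {n : ℕ} {g : W → W} (h : g ∈ S n) : g ∘ c ∈ S (n + 1) := by
  obtain ⟨w, hw, rfl⟩ := h
  exact ⟨w ++ [0], by simp [hw], wt_append w [0]⟩

lemma C_S {k : ℕ} {f : W → W} (hf : f ∈ C k) (m : ℕ) : f ∈ S (m + 2 * k + 1) := by
  induction k generalizing f with
  | zero =>
    induction m with
    | zero =>
      rcases hf with rfl | rfl
      · exact ⟨[1], rfl, rfl⟩
      · exact ⟨[2], rfl, rfl⟩
    | succ m ih =>
      rcases hf with rfl | rfl
      · have := S_cons 1 ih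
        rw [show autTrans a6Tr a6Out 1 ∘ p = p from p_C (k := 0) (Or.inl rfl)] at this
        rw [show m + 1 + 2 * 0 + 1 = m + 2 * 0 + 1 + 1 by ring]
        exact this
      · have := S_cons 2 ih
        rw [show autTrans a6Tr a6Out 2 ∘ r = r from funext r_r] at this
        rw [show m + 1 + 2 * 0 + 1 = m + 2 * 0 + 1 + 1 by ring]
        exact this
  | succ k ih =>
    rw [show m + 2 * (k + 1) + 1 = m + 2 * k + 1 + 1 + 1 by ring]
    rcases hf with ⟨g, hg, rfl⟩ | ⟨g, hg, rfl⟩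
    · exact S_cons 1 (S_cons 0 (ih hg))
    · exact S_cons 2 (S_cons 0 (ih hg))

lemma U_S {n : ℕ} {g : W → W} (h : g ∈ U n) : g ∈ S n := by
  obtain ⟨e, d, k, hn, f, hf, rfl⟩ := h
  obtain ⟨m, rfl⟩ := Nat.exists_eq_add_of_le hn
  have h := C_S hf m
  cases e <;> cases d <;> simp only [Bool.toNat_false, Bool.toNat_true]
  · refine cast (congrArg (fun n => _ ∈ S n) ?_) (h)
    omega
  · refine cast (congrArg (fun n => _ ∈ S n) ?_) (S_snoc h)
    omega
  · refine cast (congrArg (fun n => _ ∈ S n) ?_) (S_cons 0 h)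
    omega
  · refine cast (congrArg (fun n => _ ∈ S n) ?_) (S_cons 0 (S_snoc h))
    omega

lemma c_iter_S (n : ℕ) : c^[n] ∈ S n := by
  induction n with
  | zero => exact ⟨[], rfl, rfl⟩
  | succ n ih => rw [Function.iterate_succ']; exact S_cons 0 ih

lemma S_eq (n : ℕ) : S n = insert (c^[n]) (U n) := by
  ext g
  constructor
  · rintro ⟨w, rfl, rfl⟩
    exact wt_mem w
  · rintro (rfl | h)
    · exact c_iter_S n
    · exact U_S h

lemma L_even (k : ℕ) : L (2 * k + 2) = E true false k ∪ E false true k := by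
  ext g
  constructor
  · rintro ⟨e, d, j, hn, h⟩
    cases e <;> cases d <;> simp at hn
    · omega
    · obtain rfl : j = k := by omega
      exact Or.inr h
    · obtain rfl : j = k := by omega
      exact Or.inl h
    · omega
  · rintro (h | h)
    · exact ⟨_, _, _, by simp, h⟩
    · exact ⟨_, _, _, by simp, h⟩

lemma L_odd (k : ℕ) : L (2 * k + 3) = E false false (k + 1) ∪ E true true k := by
  ext g
  constructor
  · rintro ⟨e, d, j, hn, h⟩
    cases e <;> cases d <;> simp at hn
    · obtain rfl : j = k + 1 := by omega
      exact Or.inl h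
    · omega
    · omega
    · obtain rfl : j = k := by omega
      exact Or.inr h
  · rintro (h | h)
    · exact ⟨_, _, _, by simp; ring, h⟩
    · exact ⟨_, _, _, by simp, h⟩

lemma L_even_ncard (k : ℕ) : (L (2 * k + 2)).ncard = 2 * (C k).ncard := by
  rw [L_even, Set.ncard_union_eq _ (E_finite _ _ _) (E_finite _ _ _), E_ncard, E_ncard, two_mul]
  rw [Set.disjoint_left]
  intro g h h'
  simpa using (E_disj h h').1

lemma L_odd_ncard (k : ℕ) : (L (2 * k + 3)).ncard = (C (k + 1)).ncard + (C k).ncard := by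
  rw [L_odd, Set.ncard_union_eq _ (E_finite _ _ _) (E_finite _ _ _), E_ncard, E_ncard]
  rw [Set.disjoint_left]
  intro g h h'
  simpa using (E_disj h h').1

lemma L_finite (n : ℕ) : (L n).Finite := by
  rcases Nat.lt_or_ge n 2 with h | h
  · refine (E_finite false false 0).subset ?_
    rintro g ⟨e, d, j, hn, h⟩
    cases e <;> cases d <;> simp at hn
    · obtain rfl : j = 0 := by omega
      exact h
    all_goals omega
  · rcases Nat.even_or_odd' n with ⟨k, rfl | rfl⟩
    · obtain ⟨j, rfl⟩ : ∃ j, k = j + 1 := ⟨k - 1, by omega⟩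
      rw [show 2 * (j + 1) = 2 * j + 2 by ring, L_even]
      exact (E_finite _ _ _).union (E_finite _ _ _)
    · obtain ⟨j, rfl⟩ : ∃ j, k = j + 1 := ⟨k - 1, by omega⟩
      rw [show 2 * (j + 1) + 1 = 2 * j + 3 by ring, L_odd]
      exact (E_finite _ _ _).union (E_finite _ _ _)

lemma U_succ (n : ℕ) : U (n + 1) = U n ∪ L (n + 1) := by
  ext g
  constructor
  · rintro ⟨e, d, j, hn, h⟩
    rcases Nat.lt_or_ge (2 * j + 1 + e.toNat + d.toNat) (n + 1) with h1 | h1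
    · exact Or.inl ⟨e, d, j, by omega, h⟩
    · exact Or.inr ⟨e, d, j, by omega, h⟩
  · rintro (⟨e, d, j, hn, h⟩ | ⟨e, d, j, hn, h⟩)
    · exact ⟨e, d, j, by omega, h⟩
    · exact ⟨e, d, j, by omega, h⟩

lemma U_finite (n : ℕ) : (U n).Finite := by
  induction n with
  | zero =>
    refine Set.finite_empty.subset ?_
    rintro g ⟨e, d, j, hn, h⟩
    omega
  | succ n ih => rw [U_succ]; exact ih.union (L_finite _)

lemma U_ncard (n : ℕ) : (U (n + 1)).ncard = (U n).ncard + (L (n + 1)).ncard := by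
  rw [U_succ, Set.ncard_union_eq _ (U_finite _) (L_finite _)]
  rw [Set.disjoint_left]
  rintro g ⟨e, d, j, hn, h⟩ ⟨e', d', j', hn', h'⟩
  obtain ⟨rfl, rfl, rfl⟩ := E_disj h h'
  omega

lemma growth_eq (n : ℕ) : growth a6Tr a6Out n = (U n).ncard + 1 := by
  change (S n).ncard = _
  rw [S_eq, Set.ncard_insert_of_notMem _ (U_finite n)]
  rintro ⟨e, d, j, hn, h⟩
  exact E_not_surj h (c_iter_surj n)

lemma growth_even (k : ℕ) : growth a6Tr a6Out (2 * k + 2) + 2 =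
    growth a6Tr a6Out (2 * k + 1) + 2 * Phi (k + 3) := by
  rw [growth_eq, growth_eq, U_ncard (2 * k + 1), L_even_ncard]
  have := (counts k).1
  omega

lemma growth_odd (k : ℕ) : growth a6Tr a6Out (2 * k + 3) + 2 =
    growth a6Tr a6Out (2 * k + 2) + Phi (k + 5) := by
  rw [growth_eq, growth_eq, U_ncard (2 * k + 2), L_odd_ncard]
  have h1 := (counts k).1
  have h2 := (counts (k + 1)).1
  have h3 : Phi (k + 5) = Phi (k + 4) + Phi (k + 3) := rfl
  rw [show k + 1 + 3 = k + 4 by ring] at h2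
  omega

lemma second (k : ℕ) :
    fdiff (fun n => (growth a6Tr a6Out n : ℤ)) 2 (2 * k + 3) = Phi (k + 2) ∧
    fdiff (fun n => (growth a6Tr a6Out n : ℤ)) 2 (2 * k + 4) = Phi (k + 2) := by
  have h1 := growth_even k
  have h2 := growth_odd k
  have h3 := growth_even (k + 1)
  rw [show 2 * (k + 1) + 2 = 2 * k + 4 by ring, show 2 * (k + 1) + 1 = 2 * k + 3 by ring,
    show k + 1 + 3 = k + 4 by ring] at h3
  have e1 : Phi (k + 5) = Phi (k + 4) + Phi (k + 3) := rfl
  have e2 : Phi (k + 4) = Phi (k + 3) + Phi (k + 2) := rfl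
  simp only [fdiff, show 2 * k + 3 - 1 = 2 * k + 2 by omega,
    show 2 * k + 2 - 1 = 2 * k + 1 by omega, show 2 * k + 4 - 1 = 2 * k + 3 by omega]
  constructor <;> omega

end A6

/-- The finite differences of the growth function `γ` of the automaton `A₆`: for every
`k ≥ 1`, `γ(2k+1) − γ(2k) = Φ_{k+4} − 2`; for every `k ≥ 0`,
`γ(2k+2) − γ(2k+1) = 2·Φ_{k+3} − 2` (both stated additively in `ℕ`); for every `k ≥ 1`,
`γ^(2)(2k+1) = γ^(2)(2k+2) = Φ_{k+1}`; in particular the second finite difference of `γ`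
consists of doubled values: `γ^(2)(n) = γ^(2)(n−1)` for every even `n ≥ 4`. -/
theorem fdiff_a6 :
    (∀ k : ℕ, 1 ≤ k →
      growth a6Tr a6Out (2 * k + 1) + 2 = growth a6Tr a6Out (2 * k) + Phi (k + 4)) ∧
    (∀ k : ℕ,
      growth a6Tr a6Out (2 * k + 2) + 2 = growth a6Tr a6Out (2 * k + 1) + 2 * Phi (k + 3)) ∧
    (∀ k : ℕ, 1 ≤ k →
      fdiff (fun n => (growth a6Tr a6Out n : ℤ)) 2 (2 * k + 1) = Phi (k + 1) ∧
      fdiff (fun n => (growth a6Tr a6Out n : ℤ)) 2 (2 * k + 2) = Phi (k + 1)) ∧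
    (∀ n : ℕ, Even n → 4 ≤ n →
      fdiff (fun k => (growth a6Tr a6Out k : ℤ)) 2 n =
        fdiff (fun k => (growth a6Tr a6Out k : ℤ)) 2 (n - 1)) := by
  refine ⟨?_, A6.growth_even, ?_, ?_⟩
  · intro k hk
    obtain ⟨j, rfl⟩ : ∃ j, k = j + 1 := ⟨k - 1, by omega⟩
    exact A6.growth_odd j
  · intro k hk
    obtain ⟨j, rfl⟩ : ∃ j, k = j + 1 := ⟨k - 1, by omega⟩
    exact A6.second j
  · intro n hn h4
    obtain ⟨k, rfl⟩ := hn
    obtain ⟨j, rfl⟩ : ∃ j, k = j + 2 := ⟨k - 2, by omega⟩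
    rw [show j + 2 + (j + 2) = 2 * j + 4 by ring, show 2 * j + 4 - 1 = 2 * j + 3 by omega,
      (A6.second j).1, (A6.second j).2]
end
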